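/- arXiv:2407.06361 — 2 statements merged into one kernel-verified Lean document; each statement's English description precedes it below -/
import Mathlib

section
/- Fix distinct points x, z ∈ S¹ and let A = {x, z} ∪ {y ∈ S¹ : (x,y,z) is positively oriented} denote the corresponding closed arc of S¹ from x to z. The map η : A → ℙ(x¹ + z¹) defined by η(y) = the 1-dimensional subspace ξ²(y) ∩ (x¹ + z¹) for y ∉ {x,z}, η(x) = ξ¹(x), and η(z) = ξ¹(z), is well defined and is a homeomorphism of A onto the closure of one of the two connected components of ℙ(x¹ + z¹) ∖ {ξ¹(x), ξ¹(z)}, where ℙ(x¹ + z¹) = {p ∈ ℙ(ℝ³) : p ⊆ x¹ + z¹}. -/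
noncomputable section

open Filter Topology Module
open scoped LinearAlgebra.Projectivization

namespace CFF

instance {K V : Type*} [DivisionRing K] [AddCommGroup V] [Module K V] [TopologicalSpace V] :
    TopologicalSpace (ℙ K V) :=
  inferInstanceAs (TopologicalSpace (Quotient (projectivizationSetoid K V)))

instance : TopologicalSpace (Module.Dual ℝ (Fin 3 → ℝ)) :=
  TopologicalSpace.induced (LinearEquiv.piRing ℝ ℝ (Fin 3) ℝ) inferInstance

/-- The projective line in `ℙ(ℝ³)` determined by a plane `W ≤ ℝ³`. -/
def projLine (W : Submodule ℝ (Fin 3 → ℝ)) : Set (ℙ ℝ (Fin 3 → ℝ)) :=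
  {p | p.submodule ≤ W}

/-- `C ⊆ ℙ(ℝ³)` is properly convex: there is a linear functional `f` nonzero on every nonzero
vector spanning a point of the closure of `C`, such that the image of `C` in the affine chart
`{[v] : f v = 1}` is convex. -/
def ProperlyConvex (C : Set (ℙ ℝ (Fin 3 → ℝ))) : Prop :=
  ∃ f : (Fin 3 → ℝ) →ₗ[ℝ] ℝ,
    (∀ (v : Fin 3 → ℝ) (hv : v ≠ 0), Projectivization.mk ℝ v hv ∈ closure C → f v ≠ 0) ∧
    Convex ℝ {w : Fin 3 → ℝ | f w = 1 ∧ ∃ hw : w ≠ 0, Projectivization.mk ℝ w hw ∈ C}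

/-- The frontier of `C` contains no three distinct collinear points. -/
def StrictlyConvexBoundary (C : Set (ℙ ℝ (Fin 3 → ℝ))) : Prop :=
  ∀ p q r : ℙ ℝ (Fin 3 → ℝ), p ∈ frontier C → q ∈ frontier C → r ∈ frontier C →
    p ≠ q → p ≠ r → q ≠ r →
    ∀ W : Submodule ℝ (Fin 3 → ℝ), finrank ℝ W = 2 →
      ¬ (p.submodule ≤ W ∧ q.submodule ≤ W ∧ r.submodule ≤ W)

/-- `W` determines a supporting line of `C` at the frontier point `p`: a projective line
containing `p` and disjoint from `C`. -/
def IsSupportingLineAt (C : Set (ℙ ℝ (Fin 3 → ℝ))) (W : Submodule ℝ (Fin 3 → ℝ))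
    (p : ℙ ℝ (Fin 3 → ℝ)) : Prop :=
  finrank ℝ W = 2 ∧ p ∈ frontier C ∧ p.submodule ≤ W ∧ projLine W ∩ C = ∅

/-- `(x, y, z)` is a positively oriented triple on the circle: `y` and `z` occur in that order
when traversing the circle counterclockwise starting from `x`.  (This implies the three points
are pairwise distinct.) -/
def PosOriented (x y z : Circle) : Prop :=
  ∃ a b c : ℝ, Circle.exp a = x ∧ Circle.exp b = y ∧ Circle.exp c = z ∧
    a < b ∧ b < c ∧ c < a + 2 * Real.pi

/-- The space of flags `(p, l)`, realized inside `ℙ(ℝ³) × ℙ((ℝ³)*)`: the pair `(p, φ)`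
represents the flag whose line is the plane annihilated by `φ`, and `p` must lie on it. -/
def Flags : Set (ℙ ℝ (Fin 3 → ℝ) × ℙ ℝ (Module.Dual ℝ (Fin 3 → ℝ))) :=
  {pl | pl.1.submodule ≤ pl.2.submodule.dualCoannihilator}

/-- The flags `(p, l)` with `p` outside the closure of `C` and `ℙ(l)` meeting `C`. -/
def Omega2 (C : Set (ℙ ℝ (Fin 3 → ℝ))) :
    Set (ℙ ℝ (Fin 3 → ℝ) × ℙ ℝ (Module.Dual ℝ (Fin 3 → ℝ))) :=
  {pl | pl ∈ Flags ∧ pl.1 ∉ closure C ∧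
    ∃ q ∈ C, q.submodule ≤ pl.2.submodule.dualCoannihilator}


abbrev E3 := Fin 3 → ℝ

lemma oq : IsOpenQuotientMap (Projectivization.mk' ℝ : {v : E3 // v ≠ 0} → ℙ ℝ E3) := by
  refine ⟨Quotient.mk''_surjective, continuous_quot_mk, ?_⟩
  intro U hU
  change IsOpen ((Projectivization.mk' ℝ : {v : E3 // v ≠ 0} → ℙ ℝ E3) ⁻¹' _)
  have : ((Projectivization.mk' ℝ : {v : E3 // v ≠ 0} → ℙ ℝ E3) ⁻¹'
      ((Projectivization.mk' ℝ : {v : E3 // v ≠ 0} → ℙ ℝ E3) '' U)) =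
      ⋃ a : ℝˣ, (fun v : {v : E3 // v ≠ 0} =>
        (⟨a • v.1, by simpa [Units.smul_def] using v.2⟩ : {v : E3 // v ≠ 0})) ⁻¹' U := by
    ext v
    simp only [Set.mem_preimage, Set.mem_image, Set.mem_iUnion]
    constructor
    · rintro ⟨w, hw, h⟩
      obtain ⟨a, ha⟩ := (Projectivization.mk_eq_mk_iff ℝ _ _ w.2 v.2).1 h
      refine ⟨a, ?_⟩
      convert hw
    · rintro ⟨a, ha⟩
      refine ⟨_, ha, ?_⟩
      exact (Projectivization.mk_eq_mk_iff ℝ _ _ _ _).2 ⟨a, rfl⟩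
  rw [this]
  refine isOpen_iUnion fun a => hU.preimage ?_
  simp only [Units.smul_def]
  fun_prop

def rho (f : E3 →ₗ[ℝ] ℝ) : ℙ ℝ E3 → E3 :=
  Projectivization.lift (fun v => (f v.1)⁻¹ • v.1) (by
    rintro ⟨a, ha⟩ ⟨b, hb⟩ t h
    simp only at h
    subst h
    have ht : t ≠ 0 := by rintro rfl; simp at ha
    simp only [map_smul, smul_eq_mul, smul_smul]
    congr 1
    by_cases hfb : f b = 0
    · simp [hfb]
    · field_simp)

lemma rho_mk (f : E3 →ₗ[ℝ] ℝ) (v : E3) (hv : v ≠ 0) :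
    rho f (Projectivization.mk ℝ v hv) = (f v)⁻¹ • v := rfl

lemma rho_cont (f : E3 →ₗ[ℝ] ℝ) (v : E3) (hv : v ≠ 0) (h : f v ≠ 0) :
    ContinuousAt (rho f) (Projectivization.mk ℝ v hv) := by
  have hf : Continuous f := f.continuous_of_finiteDimensional
  have : ContinuousAt (rho f ∘ Projectivization.mk' ℝ) ⟨v, hv⟩ := by
    change ContinuousAt (fun w : {v : E3 // v ≠ 0} => (f w.1)⁻¹ • w.1) ⟨v, hv⟩
    have h1 : ContinuousAt (fun w : {v : E3 // v ≠ 0} => f w.1) ⟨v, hv⟩ :=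
      (hf.comp continuous_subtype_val).continuousAt
    have h2 : ContinuousAt (fun w : {v : E3 // v ≠ 0} => w.1) ⟨v, hv⟩ :=
      continuous_subtype_val.continuousAt
    exact (h1.inv₀ h).smul h2
  exact oq.continuousAt_comp_iff.1 this

lemma mk_cont {X : Type*} [TopologicalSpace X] (s : X → E3) (hs : Continuous s)
    (h : ∀ t, s t ≠ 0) : Continuous fun t => Projectivization.mk ℝ (s t) (h t) := by
  have : Continuous fun t => (⟨s t, h t⟩ : {v : E3 // v ≠ 0}) := by fun_prop
  exact oq.continuous.comp this

lemma isOpen_of (S : Set (ℙ ℝ E3)) (T : Set E3) (hT : IsOpen T)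
    (h : ∀ v hv, Projectivization.mk ℝ v hv ∈ S ↔ v ∈ T) : IsOpen S := by
  rw [← oq.isQuotientMap.isOpen_preimage]
  have : (Projectivization.mk' ℝ : {v : E3 // v ≠ 0} → ℙ ℝ E3) ⁻¹' S = Subtype.val ⁻¹' T := by
    ext v; exact h v.1 v.2
  rw [this]; exact hT.preimage continuous_subtype_val

lemma isClosed_of (S : Set (ℙ ℝ E3)) (T : Set E3) (hT : IsClosed T)
    (h : ∀ v hv, Projectivization.mk ℝ v hv ∈ S ↔ v ∈ T) : IsClosed S := by
  rw [← isOpen_compl_iff] at *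
  exact isOpen_of _ _ hT fun v hv => not_congr (h v hv)

/-- The open cone over `C`. -/
def cone (C : Set (ℙ ℝ E3)) (f : E3 →ₗ[ℝ] ℝ) : Set E3 :=
  {v | 0 < f v ∧ ∃ hv : v ≠ 0, Projectivization.mk ℝ v hv ∈ C}

lemma mk_smul (v : E3) (hv : v ≠ 0) (c : ℝ) (hc : c • v ≠ 0) :
    Projectivization.mk ℝ (c • v) hc = Projectivization.mk ℝ v hv :=
  (Projectivization.mk_eq_mk_iff' ℝ _ _ _ _).2 ⟨c, rfl⟩

lemma cone_smul {C : Set (ℙ ℝ E3)} {f : E3 →ₗ[ℝ] ℝ} {v : E3} (h : v ∈ cone C f) {c : ℝ}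
    (hc : 0 < c) : c • v ∈ cone C f := by
  obtain ⟨h1, h2, h3⟩ := h
  have : c • v ≠ 0 := smul_ne_zero hc.ne' h2
  refine ⟨by simpa using mul_pos hc h1, this, ?_⟩
  rwa [mk_smul v h2]

lemma cone_open {C : Set (ℙ ℝ E3)} (hC : IsOpen C) (f : E3 →ₗ[ℝ] ℝ) : IsOpen (cone C f) := by
  have hf : Continuous f := f.continuous_of_finiteDimensional
  have h1 : IsOpen (Subtype.val '' ((Projectivization.mk' ℝ : {v : E3 // v ≠ 0} → ℙ ℝ E3) ⁻¹' C)) :=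
    (isOpen_compl_singleton (x := (0 : E3))).isOpenMap_subtype_val _ (hC.preimage oq.continuous)
  have : cone C f = {v | 0 < f v} ∩
      (Subtype.val '' ((Projectivization.mk' ℝ : {v : E3 // v ≠ 0} → ℙ ℝ E3) ⁻¹' C)) := by
    ext v
    simp [cone]
  rw [this]
  exact (isOpen_lt continuous_const hf).inter h1

lemma cone_convex {C : Set (ℙ ℝ E3)} {f : E3 →ₗ[ℝ] ℝ}
    (h : Convex ℝ {w : E3 | f w = 1 ∧ ∃ hw : w ≠ 0, Projectivization.mk ℝ w hw ∈ C}) :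
    Convex ℝ (cone C f) := by
  have key : ∀ v ∈ cone C f, (f v)⁻¹ • v ∈
      {w : E3 | f w = 1 ∧ ∃ hw : w ≠ 0, Projectivization.mk ℝ w hw ∈ C} := by
    intro v hv
    obtain ⟨_, h2⟩ := cone_smul hv (inv_pos.2 hv.1)
    refine ⟨?_, h2⟩
    simp [hv.1.ne']
  rw [convex_iff_forall_pos]
  intro u hu v hv a b ha hb hab
  have hu1 := hu.1
  have hv1 := hv.1
  have hs : 0 < a * f u + b * f v := by positivity
  have h3 := h (key u hu) (key v hv) (a := a * f u / (a * f u + b * f v))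
    (b := b * f v / (a * f u + b * f v)) (by positivity) (by positivity) (by field_simp)
  have h4 : (a * f u / (a * f u + b * f v)) • (f u)⁻¹ • u + (b * f v / (a * f u + b * f v)) • (f v)⁻¹ • v
      = (a * f u + b * f v)⁻¹ • (a • u + b • v) := by
    simp only [smul_smul, smul_add]
    congr 2 <;> field_simp
  rw [h4] at h3
  have h5 : (a * f u + b * f v)⁻¹ • (a • u + b • v) ∈ cone C f := ⟨by rw [h3.1]; norm_num, h3.2⟩
  have := cone_smul h5 hs
  rwa [smul_smul, mul_inv_cancel₀ hs.ne', one_smul] at this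

lemma mk_mem_closure {C : Set (ℙ ℝ E3)} {f : E3 →ₗ[ℝ] ℝ} {v : E3} (hv : v ≠ 0)
    (h : v ∈ closure (cone C f)) : Projectivization.mk ℝ v hv ∈ closure C := by
  rw [mem_closure_iff] at *
  intro O hO hvO
  obtain ⟨O', hO', he⟩ := isOpen_induced_iff.1 (hO.preimage oq.continuous)
  have hvO' : v ∈ O' := by
    have : (⟨v, hv⟩ : {v : E3 // v ≠ 0}) ∈ Subtype.val ⁻¹' O' := by rw [he]; exact hvO
    exact this
  obtain ⟨w, hw, hw1, hw2, hw3⟩ := h O' hO' hvO'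
  refine ⟨_, ?_, hw3⟩
  have : (⟨w, hw2⟩ : {v : E3 // v ≠ 0}) ∈ (Projectivization.mk' ℝ : {v : E3 // v ≠ 0} → ℙ ℝ E3) ⁻¹' O := by
    rw [← he]; exact hw
  exact this

lemma mk_mem_frontier {C : Set (ℙ ℝ E3)} (hC : IsOpen C) {f : E3 →ₗ[ℝ] ℝ} {v : E3} (hv : v ≠ 0)
    (hfv : 0 < f v)
    (h : v ∈ closure (cone C f)) (h' : v ∉ cone C f) : Projectivization.mk ℝ v hv ∈ frontier C := by
  rw [hC.frontier_eq]
  exact ⟨mk_mem_closure hv h, fun h2 => h' ⟨hfv, hv, h2⟩⟩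

lemma mk_rho (f : E3 →ₗ[ℝ] ℝ) (p : ℙ ℝ E3) (h : f p.rep ≠ 0) :
    ∃ h0 : rho f p ≠ 0, Projectivization.mk ℝ (rho f p) h0 = p ∧ f (rho f p) = 1 := by
  have h1 : rho f p = (f p.rep)⁻¹ • p.rep := by
    conv_lhs => rw [← p.mk_rep]
    rfl
  rw [h1]
  have h2 : (f p.rep)⁻¹ • p.rep ≠ 0 := smul_ne_zero (inv_ne_zero h) p.rep_nonzero
  refine ⟨h2, ?_, by simp [h]⟩
  rw [mk_smul _ p.rep_nonzero, p.mk_rep]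

lemma rho_mem_closure {C : Set (ℙ ℝ E3)} {f : E3 →ₗ[ℝ] ℝ}
    (hf : ∀ (v : Fin 3 → ℝ) (hv : v ≠ 0), Projectivization.mk ℝ v hv ∈ closure C → f v ≠ 0)
    {p : ℙ ℝ E3} (hp : p ∈ closure C) : rho f p ∈ closure (cone C f) := by
  have hc : ContinuousAt (rho f) p := by
    have := rho_cont f p.rep p.rep_nonzero (hf _ p.rep_nonzero (by rwa [p.mk_rep]))
    rwa [p.mk_rep] at this
  refine hc.continuousWithinAt.mem_closure hp ?_
  intro q hq
  obtain ⟨h0, h1, h2⟩ := mk_rho f q (hf _ q.rep_nonzero (by rw [q.mk_rep]; exact subset_closure hq))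
  exact ⟨by rw [h2]; norm_num, h0, by rwa [h1]⟩

/-- closed graph argument -/
lemma core {D : Set E3} (hD : IsOpen D) (g : Circle → E3) (hg : Continuous g) (m : E3)
    (hm : m ∈ D) (ξ₂ : Circle → Submodule ℝ E3)
    (hex : ∀ y, ∃ u : E3, (∀ v ∈ D, 0 < u ⬝ᵥ v) ∧ u ⬝ᵥ g y = 0)
    (hker : ∀ y, ∀ u : E3, (∀ v ∈ D, 0 < u ⬝ᵥ v) → u ⬝ᵥ g y = 0 → ∀ v, v ∈ ξ₂ y ↔ u ⬝ᵥ v = 0) :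
    ∃ φ : Circle → E3, Continuous φ ∧ ∀ y, (∀ v ∈ D, 0 < φ y ⬝ᵥ v) ∧ φ y ⬝ᵥ g y = 0 ∧
      φ y ⬝ᵥ m = 1 := by
  have hex' : ∀ y, ∃ u : E3, (∀ v ∈ D, 0 < u ⬝ᵥ v) ∧ u ⬝ᵥ g y = 0 ∧ u ⬝ᵥ m = 1 := by
    intro y
    obtain ⟨u, h1, h2⟩ := hex y
    have h3 := h1 m hm
    refine ⟨(u ⬝ᵥ m)⁻¹ • u, fun v hv => ?_, ?_, ?_⟩
    · rw [smul_dotProduct]; have := h1 v hv; simp only [smul_eq_mul]; positivity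
    · simp [smul_dotProduct, h2]
    · simp [smul_dotProduct, h3.ne']
  choose φ hφ using hex'
  refine ⟨φ, ?_, hφ⟩
  -- uniqueness
  have huniq : ∀ y u, (∀ v ∈ D, 0 ≤ u ⬝ᵥ v) → u ⬝ᵥ g y = 0 → u ⬝ᵥ m = 1 → u = φ y := by
    intro y u h1 h2 h3
    have hu0 : u ≠ 0 := by rintro rfl; simp at h3
    have h1' : ∀ v ∈ D, 0 < u ⬝ᵥ v := by
      intro v hv
      refine lt_of_le_of_ne (h1 v hv) fun h0 => ?_
      have hc : Continuous fun t : ℝ => v - t • u := by fun_prop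
      have h5 : ∀ᶠ t in 𝓝 (0 : ℝ), v - t • u ∈ D :=
        hc.continuousAt.eventually_mem (hD.mem_nhds (by simpa using hv))
      have h6 : ∀ᶠ t in 𝓝[>] (0 : ℝ), v - t • u ∈ D := nhdsWithin_le_nhds h5
      obtain ⟨t, ht, ht0⟩ := (h6.and self_mem_nhdsWithin).exists
      have h7 := h1 _ ht
      have h8 : 0 < u ⬝ᵥ u := by
        have : 0 ≤ u ⬝ᵥ u := by
          rw [dotProduct]; exact Finset.sum_nonneg fun i _ => mul_self_nonneg _
        exact lt_of_le_of_ne this fun h => hu0 (dotProduct_self_eq_zero.1 h.symm)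
      rw [dotProduct_sub, dotProduct_smul, ← h0, smul_eq_mul] at h7
      have : 0 < t * (u ⬝ᵥ u) := mul_pos ht0 h8
      linarith
    have k1 := hker y u h1' h2
    have k2 := hker y (φ y) (hφ y).1 (hφ y).2.1
    have k3 : ∀ v, u ⬝ᵥ v = φ y ⬝ᵥ v := by
      intro v
      have : u ⬝ᵥ (v - (u ⬝ᵥ v) • m) = 0 := by
        rw [dotProduct_sub, dotProduct_smul, h3]; simp
      rw [← k1, k2, dotProduct_sub, dotProduct_smul, (hφ y).2.2] at this
      simp at this; linarith
    exact dotProduct_eq _ _ k3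
  obtain ⟨ε, hε, hball⟩ := Metric.isOpen_iff.1 hD m hm
  have hbd : ∀ y, φ y ∈ Set.Icc (fun _ => -(2 / ε) : E3) (fun _ => 2 / ε) := by
    intro y
    have hh : ∀ (i : Fin 3) (s : ℝ), |s| < ε → 0 < 1 + s * φ y i := by
      intro i s hs
      have : m + Pi.single i s ∈ D := by
        apply hball
        simp only [Metric.mem_ball, dist_self_add_left, Pi.norm_single]
        exact hs
      have := (hφ y).1 _ this
      rw [dotProduct_add, (hφ y).2.2, dotProduct_single] at this
      linarith
    have hp : |ε / 2| < ε := by rw [abs_of_pos (by positivity)]; linarith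
    constructor
    · intro i
      have := hh i (ε / 2) hp
      simp only
      rw [neg_le, le_div_iff₀ hε]; linarith
    · intro i
      have := hh i (-(ε / 2)) (by rwa [abs_neg])
      simp only
      rw [le_div_iff₀ hε]; linarith
  refine continuous_iff_isClosed.2 fun F hF => ?_
  have hK : IsCompact (Set.Icc (fun _ => -(2 / ε) : E3) (fun _ => 2 / ε)) := isCompact_Icc
  have hG : IsClosed {q : Circle × E3 | (∀ v ∈ D, 0 ≤ q.2 ⬝ᵥ v) ∧ q.2 ⬝ᵥ g q.1 = 0 ∧ q.2 ⬝ᵥ m = 1 ∧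
      q.2 ∈ F} := by
    have c1 : ∀ v : E3, Continuous fun q : Circle × E3 => q.2 ⬝ᵥ v := fun v =>
      continuous_snd.dotProduct continuous_const
    have c2 : Continuous fun q : Circle × E3 => q.2 ⬝ᵥ g q.1 :=
      continuous_snd.dotProduct (hg.comp continuous_fst)
    refine IsClosed.and ?_ (IsClosed.and ?_ (IsClosed.and ?_ ?_))
    · simp only [Set.ofPred_forall]
      exact isClosed_iInter fun v => isClosed_iInter fun _ => isClosed_le continuous_const (c1 v)
    · exact isClosed_eq c2 continuous_const
    · exact isClosed_eq (c1 m) continuous_const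
    · exact hF.preimage continuous_snd
  have hcomp := ((isCompact_univ (X := Circle)).prod hK).inter_right hG
  have himg := (hcomp.image continuous_fst).isClosed
  convert himg using 1
  ext y
  simp only [Set.mem_preimage, Set.mem_image, Set.mem_inter_iff, Set.mem_prod, Set.mem_univ,
    true_and, Set.mem_ofPred_eq, Prod.exists, exists_and_right, exists_eq_right]
  constructor
  · intro h
    exact ⟨φ y, hbd y, fun v hv => ((hφ y).1 v hv).le, (hφ y).2.1, (hφ y).2.2, h⟩
  · rintro ⟨u, _, h1, h2, h3, h4⟩
    rwa [← huniq y u h1 h2 h3]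

lemma arc (x z : Circle) (hxz : x ≠ z) : ∃ a c : ℝ, Circle.exp a = x ∧ Circle.exp c = z ∧ a < c ∧
    c < a + 2 * Real.pi ∧ {y | PosOriented x y z} = Circle.exp '' Set.Ioo a c := by
  have hpi := Real.pi_pos
  have hp2 : 0 < 2 * Real.pi := by positivity
  obtain ⟨a, rfl⟩ : ∃ a, Circle.exp a = x := ⟨_, Circle.exp_arg x⟩
  obtain ⟨c', rfl⟩ : ∃ a, Circle.exp a = z := ⟨_, Circle.exp_arg z⟩
  obtain ⟨n, ⟨hn1, hn2⟩, -⟩ := existsUnique_add_zsmul_mem_Ico hp2 c' a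
  simp only [zsmul_eq_mul] at hn1 hn2
  have hc : Circle.exp (c' + n * (2 * Real.pi)) = Circle.exp c' := Circle.exp_eq_exp.2 ⟨n, rfl⟩
  have hlt : a < c' + n * (2 * Real.pi) := by
    refine lt_of_le_of_ne hn1 fun h => hxz ?_
    rw [h, hc]
  refine ⟨a, c' + n * (2 * Real.pi), rfl, hc, hlt, hn2, ?_⟩
  generalize c' + n * (2 * Real.pi) = c at *
  rw [← hc]
  ext y
  constructor
  · rintro ⟨a1, b1, c1, ha, hb, hc1, h1, h2, h3⟩
    obtain ⟨k, rfl⟩ := Circle.exp_eq_exp.1 ha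
    obtain ⟨l, rfl⟩ := Circle.exp_eq_exp.1 hc1
    have hkl : l = k := by
      have e1 : ((l - k : ℤ) : ℝ) * (2 * Real.pi) < 1 * (2 * Real.pi) := by push_cast; linarith
      have e2 : (-1) * (2 * Real.pi) < ((l - k : ℤ) : ℝ) * (2 * Real.pi) := by push_cast; linarith
      have e3 := lt_of_mul_lt_mul_right e1 hp2.le
      have e4 := lt_of_mul_lt_mul_right e2 hp2.le
      have e5 : l - k < 1 := by exact_mod_cast e3
      have e6 : -1 < l - k := by exact_mod_cast e4
      omega
    subst hkl
    refine ⟨b1 - l * (2 * Real.pi), ⟨by linarith, by linarith⟩, ?_⟩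
    rw [← hb]
    exact Circle.exp_eq_exp.2 ⟨-l, by push_cast; ring⟩
  · rintro ⟨b, ⟨h1, h2⟩, rfl⟩
    exact ⟨a, b, c, rfl, rfl, rfl, h1, h2, hn2⟩

lemma mem_line (P Q α β : E3) (h1 : α ⬝ᵥ P = 1) (h2 : α ⬝ᵥ Q = 0) (h3 : β ⬝ᵥ P = 0)
    (h4 : β ⬝ᵥ Q = 1) (v : E3) :
    v ∈ Submodule.span ℝ {P} ⊔ Submodule.span ℝ {Q} ↔ v = (α ⬝ᵥ v) • P + (β ⬝ᵥ v) • Q := by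
  rw [← Submodule.span_union, Set.singleton_union, Submodule.mem_span_pair]
  constructor
  · rintro ⟨a, b, rfl⟩
    simp [dotProduct_add, dotProduct_smul, h1, h2, h3, h4]
  · intro h
    exact ⟨_, _, h.symm⟩

lemma seg_ne (P Q α β : E3) (h1 : α ⬝ᵥ P = 1) (h2 : α ⬝ᵥ Q = 0) (h3 : β ⬝ᵥ P = 0)
    (h4 : β ⬝ᵥ Q = 1) (t : ℝ) : (1 - t) • P - t • Q ≠ 0 := by
  intro h
  have e1 : α ⬝ᵥ ((1 - t) • P - t • Q) = 0 := by rw [h]; simp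
  have e2 : β ⬝ᵥ ((1 - t) • P - t • Q) = 0 := by rw [h]; simp
  simp [dotProduct_sub, dotProduct_smul, h1, h2, h3, h4] at e1 e2
  linarith

lemma component (P Q α β : E3) (h1 : α ⬝ᵥ P = 1) (h2 : α ⬝ᵥ Q = 0) (h3 : β ⬝ᵥ P = 0)
    (h4 : β ⬝ᵥ Q = 1) (hP : P ≠ 0) (hQ : Q ≠ 0) (L : Set (ℙ ℝ E3))
    (hL : L = projLine (Submodule.span ℝ {P} ⊔ Submodule.span ℝ {Q}) \
      {Projectivization.mk ℝ P hP, Projectivization.mk ℝ Q hQ})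
    (θ : ℝ → ℙ ℝ E3)
    (hθ : ∀ t, θ t = Projectivization.mk ℝ ((1 - t) • P - t • Q) (seg_ne P Q α β h1 h2 h3 h4 t)) :
    θ (1 / 2) ∈ L ∧ closure (connectedComponentIn L (θ (1 / 2))) = θ '' Set.Icc 0 1 := by
  have hθc : Continuous θ := by
    rw [show θ = _ from funext hθ]
    exact mk_cont _ (by fun_prop) _
  have hline : ∀ v hv, Projectivization.mk ℝ v hv ∈
      projLine (Submodule.span ℝ {P} ⊔ Submodule.span ℝ {Q}) ↔
      v = (α ⬝ᵥ v) • P + (β ⬝ᵥ v) • Q := by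
    intro v hv
    rw [← mem_line P Q α β h1 h2 h3 h4 v, projLine, Set.mem_ofPred_eq,
      Projectivization.submodule_mk, Submodule.span_singleton_le_iff_mem]
  have hLm : ∀ v hv, Projectivization.mk ℝ v hv ∈ L ↔
      v = (α ⬝ᵥ v) • P + (β ⬝ᵥ v) • Q ∧ α ⬝ᵥ v ≠ 0 ∧ β ⬝ᵥ v ≠ 0 := by
    intro v hv
    rw [hL, Set.mem_sdiff, hline]
    refine and_congr_right fun hv' => ?_
    simp only [Set.mem_insert_iff, Set.mem_singleton_iff, not_or, Projectivization.mk_eq_mk_iff']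
    rw [and_comm]
    refine and_congr (not_congr ?_) (not_congr ?_)
    · constructor
      · rintro ⟨a, rfl⟩
        simp [dotProduct_smul, h2]
      · intro h
        rw [h] at hv'
        exact ⟨β ⬝ᵥ v, by simpa using hv'.symm⟩
    · constructor
      · rintro ⟨a, rfl⟩
        simp [dotProduct_smul, h3]
      · intro h
        rw [h] at hv'
        exact ⟨α ⬝ᵥ v, by simpa using hv'.symm⟩
  have eα : ∀ t : ℝ, α ⬝ᵥ ((1 - t) • P - t • Q) = 1 - t := by
    intro t; simp [dotProduct_sub, dotProduct_smul, h1, h2]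
  have eβ : ∀ t : ℝ, β ⬝ᵥ ((1 - t) • P - t • Q) = - t := by
    intro t; simp [dotProduct_sub, dotProduct_smul, h3, h4]
  have hθL : ∀ t ∈ Set.Ioo (0 : ℝ) 1, θ t ∈ L := by
    intro t ht
    rw [hθ, hLm, eα, eβ]
    refine ⟨?_, by linarith [ht.2], by linarith [ht.1]⟩
    rw [neg_smul, sub_eq_add_neg]
  have hhalf : (1 / 2 : ℝ) ∈ Set.Ioo (0 : ℝ) 1 := by norm_num
  have hback : ∀ v hv, v = (α ⬝ᵥ v) • P + (β ⬝ᵥ v) • Q → (α ⬝ᵥ v) * (β ⬝ᵥ v) ≤ 0 →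
      ∃ t ∈ Set.Icc (0 : ℝ) 1, θ t = Projectivization.mk ℝ v hv ∧
        ((α ⬝ᵥ v) * (β ⬝ᵥ v) < 0 → t ∈ Set.Ioo (0 : ℝ) 1) := by
    intro v hv hvv hle
    generalize α ⬝ᵥ v = a at *
    generalize β ⬝ᵥ v = b at *
    have hab : a - b ≠ 0 := by
      intro h
      have : a = b := by linarith
      subst this
      have : a = 0 := by nlinarith
      subst this
      simp at hvv
      exact hv hvv
    have hsq : 0 < (a - b) ^ 2 := by positivity
    have key : -b / (a - b) = (-b * (a - b)) / (a - b) ^ 2 := by field_simp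
    have key2 : 1 - -b / (a - b) = (a * (a - b)) / (a - b) ^ 2 := by field_simp; ring
    refine ⟨-b / (a - b), ⟨?_, ?_⟩, ?_, fun hlt => ⟨?_, ?_⟩⟩
    · rw [key]; apply div_nonneg _ hsq.le; nlinarith
    · rw [← sub_nonneg, key2]; apply div_nonneg _ hsq.le; nlinarith
    · rw [hθ, Projectivization.mk_eq_mk_iff']
      refine ⟨(a - b)⁻¹, ?_⟩
      rw [hvv, smul_add, smul_smul, smul_smul, sub_eq_add_neg (_ • P), ← neg_smul]
      congr 2
      · field_simp; ring
      · field_simp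
    · rw [key]; apply div_pos _ hsq; nlinarith
    · rw [← sub_pos, key2]; apply div_pos _ hsq; nlinarith
  have hcα : Continuous fun v : E3 => α ⬝ᵥ v := continuous_const.dotProduct continuous_id
  have hcβ : Continuous fun v : E3 => β ⬝ᵥ v := continuous_const.dotProduct continuous_id
  have hcomp : connectedComponentIn L (θ (1 / 2)) = θ '' Set.Ioo 0 1 := by
    apply Set.Subset.antisymm
    · have hscale : ∀ (a : ℝˣ) (v : E3), (α ⬝ᵥ (a • v)) * (β ⬝ᵥ (a • v)) =
          (a : ℝ) ^ 2 * ((α ⬝ᵥ v) * (β ⬝ᵥ v)) := by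
        intro a v
        simp only [Units.smul_def, dotProduct_smul, smul_eq_mul]; ring
      have hrep : ∀ v hv, ∃ c : ℝ, 0 < c ∧ (α ⬝ᵥ (Projectivization.mk ℝ v hv).rep) *
          (β ⬝ᵥ (Projectivization.mk ℝ v hv).rep) = c * ((α ⬝ᵥ v) * (β ⬝ᵥ v)) := by
        intro v hv
        obtain ⟨a, ha⟩ := Projectivization.exists_smul_eq_mk_rep ℝ v hv
        refine ⟨(a : ℝ) ^ 2, by have := a.ne_zero; positivity, ?_⟩
        rw [← ha, hscale]
      let On : Set (ℙ ℝ E3) := {p | (α ⬝ᵥ p.rep) * (β ⬝ᵥ p.rep) < 0}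
      let Op : Set (ℙ ℝ E3) := {p | 0 < (α ⬝ᵥ p.rep) * (β ⬝ᵥ p.rep)}
      have mOn : ∀ v hv, Projectivization.mk ℝ v hv ∈ On ↔ (α ⬝ᵥ v) * (β ⬝ᵥ v) < 0 := by
        intro v hv
        obtain ⟨c, hc, he⟩ := hrep v hv
        simp only [On, Set.mem_ofPred_eq]
        rw [he]
        constructor
        · intro h; by_contra! h'; have := mul_nonneg hc.le h'; linarith
        · intro h; exact mul_neg_of_pos_of_neg hc h
      have mOp : ∀ v hv, Projectivization.mk ℝ v hv ∈ Op ↔ 0 < (α ⬝ᵥ v) * (β ⬝ᵥ v) := by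
        intro v hv
        obtain ⟨c, hc, he⟩ := hrep v hv
        simp only [Op, Set.mem_ofPred_eq]
        rw [he]
        exact mul_pos_iff_of_pos_left hc
      have oOn : IsOpen On := isOpen_of On {v | (α ⬝ᵥ v) * (β ⬝ᵥ v) < 0}
        (isOpen_lt (hcα.mul hcβ) continuous_const) mOn
      have oOp : IsOpen Op := isOpen_of Op {v | 0 < (α ⬝ᵥ v) * (β ⬝ᵥ v)}
        (isOpen_lt continuous_const (hcα.mul hcβ)) mOp
      have hdisj : Disjoint On Op := by
        rw [Set.disjoint_left]
        intro p hp hp'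
        simp only [On, Op, Set.mem_ofPred_eq] at hp hp'
        exact lt_asymm hp hp'
      have hsub : connectedComponentIn L (θ (1 / 2)) ⊆ On := by
        refine IsPreconnected.subset_left_of_subset_union oOn oOp hdisj ?_ ?_
          isPreconnected_connectedComponentIn
        · intro p hp
          have hpL := connectedComponentIn_subset _ _ hp
          induction p using Projectivization.ind with | h v hv =>
          obtain ⟨_, n1, n2⟩ := (hLm v hv).1 hpL
          rcases lt_or_gt_of_ne (mul_ne_zero n1 n2) with h | h
          · exact Or.inl ((mOn v hv).2 h)
          · exact Or.inr ((mOp v hv).2 h)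
        · refine ⟨θ (1 / 2), mem_connectedComponentIn (hθL _ hhalf), ?_⟩
          rw [hθ, mOn, eα, eβ]; norm_num
      intro p hp
      have hpL := connectedComponentIn_subset _ _ hp
      have hpO := hsub hp
      induction p using Projectivization.ind with | h v hv =>
      have hlt := (mOn v hv).1 hpO
      obtain ⟨t, _, ht, ht2⟩ := hback v hv ((hLm v hv).1 hpL).1 hlt.le
      exact ⟨t, ht2 hlt, ht⟩
    · refine IsPreconnected.subset_connectedComponentIn ?_ ⟨_, hhalf, rfl⟩ ?_
      · exact isPreconnected_Ioo.image _ hθc.continuousOn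
      · rintro _ ⟨t, ht, rfl⟩; exact hθL t ht
  refine ⟨hθL _ hhalf, ?_⟩
  rw [hcomp]
  apply Set.Subset.antisymm
  · have hcl : IsClosed (θ '' Set.Icc 0 1) := by
      refine isClosed_of _ {v | v = (α ⬝ᵥ v) • P + (β ⬝ᵥ v) • Q ∧ (α ⬝ᵥ v) * (β ⬝ᵥ v) ≤ 0} ?_ ?_
      · refine IsClosed.and (isClosed_eq continuous_id ?_)
          (isClosed_le (hcα.mul hcβ) continuous_const)
        exact (hcα.smul continuous_const).add (hcβ.smul continuous_const)
      · intro v hv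
        constructor
        · rintro ⟨t, ht, h⟩
          rw [hθ, eq_comm, Projectivization.mk_eq_mk_iff'] at h
          obtain ⟨a, rfl⟩ := h
          simp only [Set.mem_ofPred_eq, dotProduct_smul, eα, eβ, smul_eq_mul]
          constructor
          · module
          · have h5 := mul_nonneg ht.1 (sub_nonneg.2 ht.2)
            have h6 := mul_nonneg (sq_nonneg a) h5
            nlinarith
        · rintro ⟨e1, e2⟩
          obtain ⟨t, ht, h, _⟩ := hback v hv e1 e2
          exact ⟨t, ht, h⟩
    exact closure_minimal (Set.image_mono Set.Ioo_subset_Icc_self) hcl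
  · rw [← closure_Ioo (zero_ne_one)]
    exact image_closure_subset_closure_image hθc

/-- dot product with `u` as a linear map -/
def dl (u : E3) : E3 →ₗ[ℝ] ℝ where
  toFun v := u ⬝ᵥ v
  map_add' := dotProduct_add u
  map_smul' c v := by simp [dotProduct_smul]

lemma dl_apply (u v : E3) : dl u v = u ⬝ᵥ v := rfl

lemma finrank_ker_of {φ : E3 →ₗ[ℝ] ℝ} (h : φ ≠ 0) : finrank ℝ (LinearMap.ker φ) = 2 := by
  have h1 := LinearMap.finrank_range_add_finrank_ker φ
  have h2 : LinearMap.range φ = ⊤ := LinearMap.range_eq_top.2 (LinearMap.surjective h)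
  rw [h2, finrank_top] at h1
  simp at h1
  omega

lemma plane_of (u : E3) (hu : u ≠ 0) : ∃ W : Submodule ℝ E3, finrank ℝ W = 2 ∧
    ∀ v, v ∈ W ↔ u ⬝ᵥ v = 0 := by
  refine ⟨LinearMap.ker (dl u), finrank_ker_of ?_, fun v => ?_⟩
  · intro h
    apply hu
    have : dl u u = 0 := by rw [h]; rfl
    exact dotProduct_self_eq_zero.1 this
  · rw [LinearMap.mem_ker, dl_apply]

lemma of_plane (W : Submodule ℝ E3) (hW : finrank ℝ W = 2) : ∃ u : E3, u ≠ 0 ∧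
    ∀ v, v ∈ W ↔ u ⬝ᵥ v = 0 := by
  have hlt : W < ⊤ := by
    rw [lt_top_iff_ne_top]
    rintro rfl
    simp at hW
  obtain ⟨φ, h0, hle⟩ := Submodule.exists_le_ker_of_lt_top W hlt
  have heq : W = LinearMap.ker φ :=
    Submodule.eq_of_le_of_finrank_eq hle (by rw [hW, finrank_ker_of h0])
  have hφ : ∀ v, φ v = (fun i => φ (Pi.single i 1)) ⬝ᵥ v := by
    intro v
    rw [LinearMap.pi_apply_eq_sum_univ φ v, dotProduct]
    refine Finset.sum_congr rfl fun i _ => ?_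
    rw [smul_eq_mul, mul_comm]
    congr 2
    ext j
    simp [Pi.single_apply, eq_comm]
  refine ⟨fun i => φ (Pi.single i 1), ?_, fun v => ?_⟩
  · intro h
    apply h0
    ext v
    simpa using congrFun h v
  · rw [← hφ, heq, LinearMap.mem_ker]

lemma finrank_pair (f : E3 →ₗ[ℝ] ℝ) (a b : E3) (ha : f a = 1) (hb : f b = 1) (hab : a ≠ b) :
    finrank ℝ (Submodule.span ℝ (Set.range ![a, b])) = 2 := by
  rw [finrank_span_eq_card]
  · simp
  · rw [LinearIndependent.pair_iff]
    intro s t h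
    have h1 : f (s • a + t • b) = 0 := by rw [h]; simp
    simp [ha, hb] at h1
    have ht : t = -s := by linarith
    subst ht
    have h2 : s • (a - b) = 0 := by rw [← h]; module
    rcases smul_eq_zero.1 h2 with h3 | h3
    · simp [h3]
    · exact absurd (sub_eq_zero.1 h3) hab

/-- For distinct `x, z`, with `A` the closed arc from `x` to `z` consisting of
`x`, `z` and the points `y` with `(x,y,z)` positively oriented, the map `η : A → ℙ(x¹ + z¹)`
with `η(y) = ξ²(y) ∩ (x¹ + z¹)` for `y ∉ {x,z}`, `η(x) = ξ¹(x)`, `η(z) = ξ¹(z)` is well defined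
and a homeomorphism of `A` onto the closure of one of the two connected components of
`ℙ(x¹ + z¹) ∖ {ξ¹(x), ξ¹(z)}`. -/
theorem statement_2
    (C : Set (ℙ ℝ (Fin 3 → ℝ))) (hCopen : IsOpen C) (hCpc : ProperlyConvex C)
    (hstrict : StrictlyConvexBoundary C)
    (hC1 : ∀ p ∈ frontier C, ∃! W : Submodule ℝ (Fin 3 → ℝ), IsSupportingLineAt C W p)
    (ξ₁ : Circle → ℙ ℝ (Fin 3 → ℝ))
    (hξ₁ : ∃ e : Circle ≃ₜ frontier C, ∀ x, (e x : ℙ ℝ (Fin 3 → ℝ)) = ξ₁ x)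
    (ξ₂ : Circle → Submodule ℝ (Fin 3 → ℝ))
    (hξ₂ : ∀ x, IsSupportingLineAt C (ξ₂ x) (ξ₁ x))
    (x z : Circle) (hxz : x ≠ z) :
    ∃ η : Circle → ℙ ℝ (Fin 3 → ℝ),
      (∀ y, PosOriented x y z →
        (η y).submodule = ξ₂ y ⊓ ((ξ₁ x).submodule ⊔ (ξ₁ z).submodule)) ∧
      η x = ξ₁ x ∧ η z = ξ₁ z ∧
      ∃ p ∈ projLine ((ξ₁ x).submodule ⊔ (ξ₁ z).submodule) \ {ξ₁ x, ξ₁ z},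
        ∃ e : (insert x (insert z {y | PosOriented x y z}) : Set Circle) ≃ₜ
            closure (connectedComponentIn
              (projLine ((ξ₁ x).submodule ⊔ (ξ₁ z).submodule) \ {ξ₁ x, ξ₁ z}) p),
          ∀ a, (e a : ℙ ℝ (Fin 3 → ℝ)) = η ↑a := by
  obtain ⟨f, hf, hconv⟩ := hCpc
  obtain ⟨e, he⟩ := hξ₁
  have hfr : ∀ y, ξ₁ y ∈ frontier C := fun y => by rw [← he]; exact (e y).2
  have hξc : Continuous ξ₁ := by
    rw [show ξ₁ = fun y => (e y : ℙ ℝ E3) from funext fun y => (he y).symm]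
    exact continuous_subtype_val.comp e.continuous
  have hξi : Function.Injective ξ₁ := by
    intro a b h
    rw [← he, ← he] at h
    exact e.injective (Subtype.ext h)
  have hcl : ∀ y, ξ₁ y ∈ closure C := fun y => frontier_subset_closure (hfr y)
  have hfrep : ∀ p ∈ closure C, f p.rep ≠ 0 := fun p hp =>
    hf _ p.rep_nonzero (by rwa [p.mk_rep])
  set g : Circle → E3 := fun y => rho f (ξ₁ y) with hgdef
  have hg : Continuous g := by
    rw [continuous_iff_continuousAt]
    intro y
    have h1 := rho_cont f (ξ₁ y).rep (ξ₁ y).rep_nonzero (hfrep _ (hcl y))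
    rw [Projectivization.mk_rep] at h1
    exact h1.comp hξc.continuousAt
  have hgne : ∀ y, g y ≠ 0 := fun y => (mk_rho f (ξ₁ y) (hfrep _ (hcl y))).1
  have hgmk : ∀ y, Projectivization.mk ℝ (g y) (hgne y) = ξ₁ y := fun y =>
    (mk_rho f (ξ₁ y) (hfrep _ (hcl y))).2.1
  have hgf : ∀ y, f (g y) = 1 := fun y => (mk_rho f (ξ₁ y) (hfrep _ (hcl y))).2.2
  have hgi : Function.Injective g := by
    intro a b h
    apply hξi
    rw [← hgmk, ← hgmk]
    congr 1
  have hsub : ∀ y, (ξ₁ y).submodule = Submodule.span ℝ {g y} := fun y => by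
    rw [← hgmk y, Projectivization.submodule_mk]
  have hsuble : ∀ y (W : Submodule ℝ E3), (ξ₁ y).submodule ≤ W ↔ g y ∈ W := fun y W => by
    rw [hsub, Submodule.span_singleton_le_iff_mem]
  have hDo : IsOpen (cone C f) := cone_open hCopen f
  have hDc : Convex ℝ (cone C f) := cone_convex hconv
  have hgcl : ∀ y, g y ∈ closure (cone C f) := fun y => rho_mem_closure hf (hcl y)
  -- sums of distinct boundary points are interior
  have hadd : ∀ y y', y ≠ y' → g y + g y' ∈ cone C f := by
    intro y y' hyy
    have hne : g y ≠ g y' := hgi.ne hyy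
    have hw1 : (1 / 2 : ℝ) • g y + (1 / 2 : ℝ) • g y' ∈ closure (cone C f) :=
      hDc.closure (hgcl y) (hgcl y') (by norm_num) (by norm_num) (by norm_num)
    have hw : (1 / 2 : ℝ) • g y + (1 / 2 : ℝ) • g y' ∈ cone C f := by
      by_contra hnot
      have hfw : f ((1 / 2 : ℝ) • g y + (1 / 2 : ℝ) • g y') = 1 := by
        rw [map_add, map_smul, map_smul, hgf, hgf]; norm_num
      have hw0 : (1 / 2 : ℝ) • g y + (1 / 2 : ℝ) • g y' ≠ 0 := by
        intro h; rw [h] at hfw; simp at hfw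
      have hwf := mk_mem_frontier hCopen hw0 (by rw [hfw]; norm_num) hw1 hnot
      have haux : ∀ y0, ξ₁ y0 = Projectivization.mk ℝ _ hw0 →
          g y0 = (1 / 2 : ℝ) • g y + (1 / 2 : ℝ) • g y' := by
        intro y0 h
        rw [← hgmk, Projectivization.mk_eq_mk_iff'] at h
        obtain ⟨a, ha⟩ := h
        have := congrArg f ha
        rw [map_smul, hfw, hgf] at this
        simp at this
        rw [← ha, this, one_smul]
      refine hstrict (ξ₁ y) (ξ₁ y') _ (hfr y) (hfr y') hwf (hξi.ne hyy) ?_ ?_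
        (Submodule.span ℝ (Set.range ![g y, g y']))
        (finrank_pair f _ _ (hgf y) (hgf y') hne) ⟨?_, ?_, ?_⟩
      · intro h
        have h' := haux y h
        apply hne
        have : g y - g y' = (2 : ℝ) • (g y - ((1 / 2 : ℝ) • g y + (1 / 2 : ℝ) • g y')) := by module
        rw [← h', sub_self, smul_zero] at this
        exact sub_eq_zero.1 this
      · intro h
        have h' := haux y' h
        apply hne
        have : g y - g y' = (2 : ℝ) • (((1 / 2 : ℝ) • g y + (1 / 2 : ℝ) • g y') - g y') := by module
        rw [← h', sub_self, smul_zero] at this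
        exact sub_eq_zero.1 this
      · rw [hsuble]; exact Submodule.subset_span ⟨0, rfl⟩
      · rw [hsuble]; exact Submodule.subset_span ⟨1, rfl⟩
      · rw [Projectivization.submodule_mk, Submodule.span_singleton_le_iff_mem]
        exact Submodule.add_mem _ (Submodule.smul_mem _ _ (Submodule.subset_span ⟨0, rfl⟩))
          (Submodule.smul_mem _ _ (Submodule.subset_span ⟨1, rfl⟩))
    have h2 := cone_smul hw (c := 2) (by norm_num)
    have h3 : (2 : ℝ) • ((1 / 2 : ℝ) • g y + (1 / 2 : ℝ) • g y') = g y + g y' := by module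
    rwa [h3] at h2
  have hm := hadd x z hxz
  have hstr : ∀ y1 y2 y3, y1 ≠ y2 → y1 ≠ y3 → y2 ≠ y3 → ∀ u : E3, u ≠ 0 → u ⬝ᵥ g y1 = 0 →
      u ⬝ᵥ g y2 = 0 → u ⬝ᵥ g y3 = 0 → False := by
    intro y1 y2 y3 h12 h13 h23 u hu e1 e2 e3
    obtain ⟨W, hW, hWm⟩ := plane_of u hu
    refine hstrict _ _ _ (hfr y1) (hfr y2) (hfr y3) (hξi.ne h12) (hξi.ne h13) (hξi.ne h23) W hW ?_
    simp only [hsuble, hWm]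
    exact ⟨e1, e2, e3⟩
  have hex : ∀ y, ∃ u : E3, (∀ v ∈ cone C f, 0 < u ⬝ᵥ v) ∧ u ⬝ᵥ g y = 0 := by
    intro y
    obtain ⟨hr, -, hle, hdis⟩ := hξ₂ y
    obtain ⟨u, hu, hum⟩ := of_plane _ hr
    rw [hsuble, hum] at hle
    have hne : ∀ v ∈ cone C f, u ⬝ᵥ v ≠ 0 := by
      rintro v ⟨_, hv0, hvC⟩ h
      rw [← hum] at h
      have : Projectivization.mk ℝ v hv0 ∈ projLine (ξ₂ y) ∩ C := by
        refine ⟨?_, hvC⟩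
        rw [projLine, Set.mem_ofPred_eq, Projectivization.submodule_mk,
          Submodule.span_singleton_le_iff_mem]
        exact h
      rw [hdis] at this
      exact this
    have hpos : ∀ u : E3, (∀ v ∈ cone C f, u ⬝ᵥ v ≠ 0) → 0 < u ⬝ᵥ (g x + g z) →
        ∀ v ∈ cone C f, 0 < u ⬝ᵥ v := by
      intro u hne h0 v hv
      by_contra! hle
      have hlt := lt_of_le_of_ne hle (hne v hv)
      set a := u ⬝ᵥ (g x + g z) with ha
      set b := u ⬝ᵥ v with hb
      have hab : 0 < a - b := by linarith
      have hmem := hDc hv hm (a := a / (a - b)) (b := -b / (a - b)) (by positivity)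
        (div_nonneg (by linarith) hab.le) (by field_simp; ring)
      apply hne _ hmem
      rw [dotProduct_add, dotProduct_smul, dotProduct_smul, ← ha, ← hb, smul_eq_mul, smul_eq_mul]
      ring
    rcases lt_or_gt_of_ne (hne _ hm) with h | h
    · refine ⟨-u, hpos (-u) (fun v hv => ?_) ?_, ?_⟩
      · rw [neg_dotProduct]; exact neg_ne_zero.2 (hne v hv)
      · rw [neg_dotProduct]; linarith
      · rw [neg_dotProduct, hle, neg_zero]
    · exact ⟨u, hpos u hne h, hle⟩
  have hker : ∀ y, ∀ u : E3, (∀ v ∈ cone C f, 0 < u ⬝ᵥ v) → u ⬝ᵥ g y = 0 →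
      ∀ v, v ∈ ξ₂ y ↔ u ⬝ᵥ v = 0 := by
    intro y u hu huy
    have hu0 : u ≠ 0 := by
      rintro rfl
      have := hu _ hm
      simp at this
    obtain ⟨W, hW, hWm⟩ := plane_of u hu0
    have hsup : IsSupportingLineAt C W (ξ₁ y) := by
      refine ⟨hW, hfr y, ?_, ?_⟩
      · rw [hsuble, hWm]; exact huy
      · rw [Set.eq_empty_iff_forall_notMem]
        rintro p ⟨hp1, hp2⟩
        obtain ⟨h0, h1, h2⟩ := mk_rho f p (hfrep p (subset_closure hp2))
        have hD : rho f p ∈ cone C f := ⟨by rw [h2]; norm_num, h0, by rwa [h1]⟩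
        rw [projLine, Set.mem_ofPred_eq, ← h1, Projectivization.submodule_mk,
          Submodule.span_singleton_le_iff_mem, hWm] at hp1
        exact (hu _ hD).ne' hp1
    have := (hC1 _ (hfr y)).unique (hξ₂ y) hsup
    rw [this]
    exact hWm
  obtain ⟨φ, hφc, hφ⟩ := core hDo g hg _ hm ξ₂ hex hker
  have hφD := fun y => (hφ y).1
  have hφ0 := fun y => (hφ y).2.1
  have hφ1 : ∀ y, φ y ⬝ᵥ g x + φ y ⬝ᵥ g z = 1 := fun y => by
    rw [← dotProduct_add]; exact (hφ y).2.2
  have hφpos : ∀ y y', y ≠ y' → 0 < φ y ⬝ᵥ g y' := by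
    intro y y' h
    have := hφD y _ (hadd y y' h)
    rwa [dotProduct_add, hφ0, zero_add] at this
  have hφnn : ∀ y y', 0 ≤ φ y ⬝ᵥ g y' := by
    intro y y'
    by_cases h : y = y'
    · subst h; rw [hφ0]
    · exact (hφpos y y' h).le
  have a1 : φ z ⬝ᵥ g x = 1 := by have := hφ1 z; rwa [hφ0, add_zero] at this
  have b1 : φ x ⬝ᵥ g z = 1 := by have := hφ1 x; rwa [hφ0, zero_add] at this
  set h : Circle → ℝ := fun y => φ y ⬝ᵥ g x with hh
  have hhc : Continuous h := hφc.dotProduct continuous_const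
  have hhx : h x = 0 := hφ0 x
  have hhz : h z = 1 := a1
  have hz' : ∀ y, φ y ⬝ᵥ g z = 1 - h y := fun y => by rw [← hφ1 y]; simp [hh]
  have hh01 : ∀ y, h y ∈ Set.Icc (0 : ℝ) 1 := fun y =>
    ⟨hφnn y x, by have := hφnn y z; rw [hz'] at this; linarith⟩
  have hhx' : ∀ y, h y = 0 → y = x := by
    intro y hy
    by_contra hne
    exact (hφpos y x hne).ne' hy
  have hhz' : ∀ y, h y = 1 → y = z := by
    intro y hy
    by_contra hne
    have := (hφpos y z hne)
    rw [hz', hy] at this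
    linarith
  have hne := seg_ne (g x) (g z) (φ z) (φ x) a1 (hφ0 z) (hφ0 x) b1
  set θ : ℝ → ℙ ℝ E3 := fun t => Projectivization.mk ℝ ((1 - t) • g x - t • g z) (hne t) with hθ
  obtain ⟨hp, hclo⟩ := component (g x) (g z) (φ z) (φ x) a1 (hφ0 z) (hφ0 x) b1 (hgne x) (hgne z)
    (projLine ((ξ₁ x).submodule ⊔ (ξ₁ z).submodule) \ {ξ₁ x, ξ₁ z})
    (by rw [hsub, hsub, hgmk, hgmk]) θ (fun t => rfl)
  have hθc : Continuous θ := mk_cont _ (by fun_prop) _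
  have hθi : Function.Injective θ := by
    intro s t hst
    obtain ⟨a, ha⟩ := (Projectivization.mk_eq_mk_iff' ℝ _ _ _ _).1 hst
    have e1 := congrArg (fun v => φ z ⬝ᵥ v) ha
    have e2 := congrArg (fun v => φ x ⬝ᵥ v) ha
    simp only [dotProduct_smul, dotProduct_sub, a1, b1, hφ0, smul_eq_mul, mul_one, mul_zero,
      sub_zero, zero_sub] at e1 e2
    have : a = 1 := by linarith
    rw [this] at e2
    linarith
  obtain ⟨a, c, hax, hcz, hac, hca, harc⟩ := arc x z hxz
  have hA : (insert x (insert z {y | PosOriented x y z}) : Set Circle) =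
      Circle.exp '' Set.Icc a c := by
    rw [harc, ← hax, ← hcz, ← Set.image_insert_eq, ← Set.image_insert_eq]
    congr 1
    rw [Set.Ioo_insert_right hac, Set.Ioc_insert_left hac.le]
  have hox : ∀ y, PosOriented x y z → y ≠ x ∧ y ≠ z := by
    intro y hy
    have hy' : y ∈ Circle.exp '' Set.Ioo a c := by rw [← harc]; exact hy
    obtain ⟨b, ⟨hb1, hb2⟩, rfl⟩ := hy'
    have hp2 : 0 < 2 * Real.pi := Real.two_pi_pos
    have main : ∀ b' : ℝ, 0 < |b - b'| → |b - b'| < 2 * Real.pi →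
        Circle.exp b ≠ Circle.exp b' := by
      intro b' h1 h2 heq
      obtain ⟨k, hk⟩ := Circle.exp_eq_exp.1 heq
      have h3 : b - b' = k * (2 * Real.pi) := by linarith
      rw [h3, abs_mul, abs_of_pos hp2] at h1 h2
      have h4 : |(k : ℝ)| < 1 := by
        by_contra! h5
        nlinarith
      have h5 : |k| < 1 := by exact_mod_cast h4
      have h6 : k = 0 := Int.abs_lt_one_iff.1 h5
      rw [h6] at h1
      simp at h1
    constructor
    · rw [← hax]
      apply main <;> rw [abs_of_pos (by linarith)] <;> linarith
    · rw [← hcz]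
      apply main <;> rw [abs_of_neg (by linarith)] <;> linarith
  have hinj : ∀ y ∈ (insert x (insert z {y | PosOriented x y z}) : Set Circle),
      ∀ y' ∈ (insert x (insert z {y | PosOriented x y z}) : Set Circle), h y = h y' → y = y' := by
    intro y hy y' hy' heq
    rcases hy with rfl | rfl | hy
    · exact (hhx' y' (by rw [← heq, hhx])).symm
    · exact (hhz' y' (by rw [← heq, hhz])).symm
    rcases hy' with rfl | rfl | hy'
    · exact hhx' y (by rw [heq, hhx])
    · exact hhz' y (by rw [heq, hhz])
    by_contra hne'
    have d1 : 0 < (φ y' - φ y) ⬝ᵥ g y := by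
      rw [sub_dotProduct, hφ0, sub_zero]; exact hφpos y' y (Ne.symm hne')
    have d2 : (φ y' - φ y) ⬝ᵥ g y' < 0 := by
      rw [sub_dotProduct, hφ0, zero_sub, neg_lt_zero]; exact hφpos y y' hne'
    have hpre : IsPreconnected {y | PosOriented x y z} := by
      rw [harc]
      exact isPreconnected_Ioo.image _ Circle.exp.continuous.continuousOn
    have hcont : Continuous fun w => (φ y' - φ y) ⬝ᵥ g w := continuous_const.dotProduct hg
    obtain ⟨w, hw, hw0⟩ := hpre.intermediate_value hy' hy hcont.continuousOn ⟨d2.le, d1.le⟩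
    refine hstr x z w hxz (hox w hw).1.symm (hox w hw).2.symm (φ y' - φ y) ?_ ?_ ?_ hw0
    · intro h0; rw [h0] at d1; simp at d1
    · rw [sub_dotProduct]
      change h y' - h y = 0
      rw [heq, sub_self]
    · rw [sub_dotProduct, hz', hz', heq, sub_self]
  refine ⟨fun y => θ (h y), ?_, ?_, ?_, θ (1 / 2), hp, ?_⟩
  · intro y _
    rw [hsub, hsub]
    ext v
    rw [Submodule.mem_inf, mem_line (g x) (g z) (φ z) (φ x) a1 (hφ0 z) (hφ0 x) b1,
      hker y (φ y) (hφD y) (hφ0 y)]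
    simp only [hθ, Projectivization.submodule_mk, Submodule.mem_span_singleton]
    constructor
    · rintro ⟨s, rfl⟩
      constructor
      · rw [dotProduct_smul, dotProduct_sub, dotProduct_smul, dotProduct_smul, hz']
        change s • ((1 - h y) * h y - h y * (1 - h y)) = 0
        ring_nf
      · simp only [dotProduct_smul, dotProduct_sub, a1, b1, hφ0, smul_eq_mul, mul_one, mul_zero,
          sub_zero, zero_sub]
        module
    · rintro ⟨h1, h2⟩
      generalize φ z ⬝ᵥ v = p at *
      generalize φ x ⬝ᵥ v = q at *
      rw [h2, dotProduct_add, dotProduct_smul, dotProduct_smul, hz', smul_eq_mul, smul_eq_mul] at h1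
      change p * h y + q * (1 - h y) = 0 at h1
      refine ⟨p - q, ?_⟩
      rw [h2, smul_sub, smul_smul, smul_smul, sub_eq_add_neg (_ • g x), ← neg_smul]
      congr 2 <;> linarith
  · rw [← hgmk x]
    simp only [hθ, hhx]
    congr 1
    simp
  · rw [← hgmk z]
    simp only [hθ, hhz]
    rw [Projectivization.mk_eq_mk_iff']
    exact ⟨-1, by simp⟩
  · rw [hclo]
    have hcs : CompactSpace (insert x (insert z {y | PosOriented x y z}) : Set Circle) := by
      rw [← isCompact_iff_compactSpace, hA]
      exact isCompact_Icc.image Circle.exp.continuous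
    have hℓ : ∀ t : ℝ, dl (φ z - φ x) ((1 - t) • g x - t • g z) = 1 := by
      intro t
      simp only [dl_apply, sub_dotProduct, dotProduct_smul, dotProduct_sub, a1, b1, hφ0,
        smul_eq_mul, mul_one, mul_zero, sub_zero, zero_sub]
      ring
    have hrθ : ∀ t, rho (dl (φ z - φ x)) (θ t) = (1 - t) • g x - t • g z := by
      intro t
      simp only [hθ, rho_mk]
      rw [hℓ, inv_one, one_smul]
    have hT2 : T2Space (θ '' Set.Icc 0 1) := by
      refine T2Space.of_injective_continuous
        (f := fun p : θ '' Set.Icc 0 1 => rho (dl (φ z - φ x)) p.1) ?_ ?_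
      · rintro ⟨_, s, _, rfl⟩ ⟨_, t, _, rfl⟩ hst
        simp only [hrθ] at hst
        apply Subtype.ext
        simp only [hθ]
        congr 1
      · rw [continuous_iff_continuousAt]
        rintro ⟨_, s, hs, rfl⟩
        have h1 : ContinuousAt (rho (dl (φ z - φ x))) (θ s) :=
          rho_cont _ _ (hne s) (by rw [hℓ]; norm_num)
        exact ContinuousAt.comp (f := Subtype.val) (x := (⟨θ s, s, hs, rfl⟩ : θ '' Set.Icc 0 1)) h1
          continuous_subtype_val.continuousAt
    let F : (insert x (insert z {y | PosOriented x y z}) : Set Circle) → θ '' Set.Icc 0 1 :=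
      fun w => ⟨θ (h w), h w, hh01 w, rfl⟩
    have hFc : Continuous F := by
      apply Continuous.subtype_mk
      exact hθc.comp (hhc.comp continuous_subtype_val)
    have hFb : Function.Bijective F := by
      constructor
      · intro w w' hww
        exact Subtype.ext (hinj _ w.2 _ w'.2 (hθi (congrArg Subtype.val hww)))
      · rintro ⟨_, t, ht, rfl⟩
        have hivt := intermediate_value_Icc hac.le
          (hhc.comp Circle.exp.continuous).continuousOn
        have ht' : t ∈ Set.Icc ((h ∘ Circle.exp) a) ((h ∘ Circle.exp) c) := by
          simp only [Function.comp, hax, hcz, hhx, hhz]; exact ht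
        obtain ⟨b, hb, hbt⟩ := hivt ht'
        refine ⟨⟨Circle.exp b, by rw [hA]; exact ⟨b, hb, rfl⟩⟩, ?_⟩
        apply Subtype.ext
        simp only [F]
        congr 1
    exact ⟨Continuous.homeoOfEquivCompactToT2 (f := Equiv.ofBijective F hFb) hFc, fun w => rfl⟩


end CFF
end
end

section
/- Fix distinct points x, z ∈ S¹. For every y ∈ S¹ ∖ {x, z}, the point of ℙ(ℝ³) given by the 1-dimensional subspace (x¹ + z¹) ∩ ξ²(y) does not lie in the closure of C. Moreover, the map sending y to this point restricts to a homeomorphism from the open arc {y : (x,y,z) is positively oriented} onto ℙ(x¹ + z¹) ∖ closure(C), and likewise restricts to a homeomorphism from the open arc {y : (z,y,x) is positively oriented} onto ℙ(x¹ + z¹) ∖ closure(C), where ℙ(x¹ + z¹) = {p ∈ ℙ(ℝ³) : p ⊆ x¹ + z¹}. -/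
noncomputable section

open Filter Topology Module
open scoped LinearAlgebra.Projectivization

namespace CFF

abbrev V3 := Fin 3 → ℝ

lemma quot_mk : IsQuotientMap (Projectivization.mk' ℝ : {v : V3 // v ≠ 0} → ℙ ℝ V3) :=
  isQuotientMap_quotient_mk'

lemma mem_projLine (W : Submodule ℝ V3) (v : V3) (hv : v ≠ 0) :
    Projectivization.mk ℝ v hv ∈ projLine W ↔ v ∈ W := by
  rw [projLine, Set.mem_ofPred_eq, Projectivization.submodule_mk,
    Submodule.span_singleton_le_iff_mem]

def affSet (h : V3 →L[ℝ] ℝ) : Set (ℙ ℝ V3) := {p | h p.rep ≠ 0}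

lemma mk_mem_affSet (h : V3 →L[ℝ] ℝ) (v : V3) (hv : v ≠ 0) :
    Projectivization.mk ℝ v hv ∈ affSet h ↔ h v ≠ 0 := by
  obtain ⟨a, ha⟩ := Projectivization.exists_smul_eq_mk_rep ℝ v hv
  unfold affSet
  rw [Set.mem_ofPred_eq, ← ha, Units.smul_def]
  simp

lemma isOpen_affSet (h : V3 →L[ℝ] ℝ) : IsOpen (affSet h) := by
  rw [← quot_mk.isOpen_preimage]
  have : (Projectivization.mk' ℝ : {v : V3 // v ≠ 0} → ℙ ℝ V3) ⁻¹' affSet h =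
      {v | h v.1 ≠ 0} := by
    ext v
    exact mk_mem_affSet h v.1 v.2
  rw [this]
  exact isOpen_ne_fun (by fun_prop) (by fun_prop)

lemma contOn_lift {E : Type*} [TopologicalSpace E] (G : ℙ ℝ V3 → E) (g : V3 → E)
    (h : V3 →L[ℝ] ℝ)
    (hG : ∀ v hv, h v ≠ 0 → G (Projectivization.mk ℝ v hv) = g v)
    (hg : ContinuousOn g {v | h v ≠ 0}) : ContinuousOn G (affSet h) := by
  rw [quot_mk.continuousOn_isOpen_iff (isOpen_affSet h)]
  have : ContinuousOn (fun v : {v : V3 // v ≠ 0} => g v.1)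
      ((Projectivization.mk' ℝ : {v : V3 // v ≠ 0} → ℙ ℝ V3) ⁻¹' affSet h) := by
    refine hg.comp continuous_subtype_val.continuousOn ?_
    intro v hv
    exact (mk_mem_affSet h v.1 v.2).1 hv
  refine this.congr ?_
  intro v hv
  exact hG v.1 v.2 ((mk_mem_affSet h v.1 v.2).1 hv)

def aff (f : V3 →L[ℝ] ℝ) (p : ℙ ℝ V3) : V3 := (f p.rep)⁻¹ • p.rep

lemma aff_mk (f : V3 →L[ℝ] ℝ) (v : V3) (hv : v ≠ 0) :
    aff f (Projectivization.mk ℝ v hv) = (f v)⁻¹ • v := by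
  obtain ⟨a, ha⟩ := Projectivization.exists_smul_eq_mk_rep ℝ v hv
  unfold aff
  rw [← ha, Units.smul_def, map_smul, smul_smul, smul_eq_mul, mul_inv, mul_right_comm,
    inv_mul_cancel₀ a.ne_zero, one_mul]

lemma contOn_aff (f : V3 →L[ℝ] ℝ) : ContinuousOn (aff f) (affSet f) := by
  refine contOn_lift _ (fun v => (f v)⁻¹ • v) f (fun v hv _ => aff_mk f v hv) ?_
  refine ContinuousOn.smul (ContinuousOn.inv₀ (by fun_prop) (fun v hv => hv)) continuousOn_id

lemma ne_zero_of {f : V3 →L[ℝ] ℝ} {v : V3} (h : f v ≠ 0) : v ≠ 0 := by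
  rintro rfl; simp at h

lemma mk_smul_eq (v : V3) (hv : v ≠ 0) (c : ℝ) (hcv : c • v ≠ 0) :
    Projectivization.mk ℝ (c • v) hcv = Projectivization.mk ℝ v hv :=
  (Projectivization.mk_eq_mk_iff' ℝ _ _ _ _).2 ⟨c, rfl⟩

lemma exists_ker_eq (W : Submodule ℝ V3) (hW : finrank ℝ W = 2) :
    ∃ φ : V3 →L[ℝ] ℝ, LinearMap.ker (φ : V3 →ₗ[ℝ] ℝ) = W := by
  have h1 : finrank ℝ (V3 ⧸ W) = finrank ℝ ℝ := by
    have := W.finrank_quotient_add_finrank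
    simp at this ⊢
    omega
  let e := LinearEquiv.ofFinrankEq _ _ h1
  refine ⟨LinearMap.toContinuousLinearMap (e.toLinearMap ∘ₗ W.mkQ), ?_⟩
  ext v
  simp

lemma finrank_ker (φ : V3 →L[ℝ] ℝ) (h : φ ≠ 0) :
    finrank ℝ (LinearMap.ker (φ : V3 →ₗ[ℝ] ℝ)) = 2 := by
  have h1 := LinearMap.finrank_range_add_finrank_ker (φ : V3 →ₗ[ℝ] ℝ)
  have h2 : LinearMap.range (φ : V3 →ₗ[ℝ] ℝ) = ⊤ := by
    apply LinearMap.range_eq_top.2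
    apply LinearMap.surjective
    intro h0
    apply h
    ext v
    exact LinearMap.congr_fun h0 v
  rw [h2] at h1
  simp at h1
  omega

lemma exists_mul_of_ker_le (φ ψ : V3 →L[ℝ] ℝ) (h : ∀ v, φ v = 0 → ψ v = 0) :
    ∃ c : ℝ, ∀ v, ψ v = c * φ v := by
  by_cases h0 : φ = 0
  · refine ⟨0, fun v => ?_⟩
    rw [h v (by simp [h0])]; simp
  · have : ∃ w, φ w ≠ 0 := by
      by_contra hc
      push Not at hc
      exact h0 (by ext v; simp [hc])
    obtain ⟨w, hw⟩ := this
    refine ⟨ψ w / φ w, fun v => ?_⟩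
    have := h (v - (φ v / φ w) • w) (by simp; field_simp; ring)
    simp at this
    field_simp at this ⊢
    linarith

lemma continuous_of_closed_graph {A B : Type*} [TopologicalSpace A] [TopologicalSpace B]
    [CompactSpace B] (F : A → B) (h : IsClosed {p : A × B | F p.1 = p.2}) : Continuous F := by
  rw [continuous_iff_isClosed]
  intro S hS
  have : F ⁻¹' S = Prod.fst '' ({p : A × B | F p.1 = p.2} ∩ Prod.snd ⁻¹' S) := by
    ext a
    simp
  rw [this]
  exact isClosedMap_fst_of_compactSpace _ (h.inter (hS.preimage continuous_snd))

structure Good (C : Set (ℙ ℝ V3)) (ξ₁ : Circle → ℙ ℝ V3) (ξ₂ : Circle → Submodule ℝ V3)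
    (f : V3 →L[ℝ] ℝ) (Y : Circle → V3) (n : Circle → V3 →L[ℝ] ℝ) : Prop where
  contY : Continuous Y
  contn : Continuous n
  fY : ∀ y, f (Y y) = 1
  sub : ∀ y, (ξ₁ y).submodule = Submodule.span ℝ {Y y}
  nself : ∀ y, n y (Y y) = 0
  npos : ∀ y y', y ≠ y' → 0 < n y (Y y')
  kern : ∀ y, LinearMap.ker (n y : V3 →ₗ[ℝ] ℝ) = ξ₂ y
  fcl : ∀ v hv, Projectivization.mk ℝ v hv ∈ closure C → f v ≠ 0
  ncl : ∀ v hv, Projectivization.mk ℝ v hv ∈ closure C → ∀ y, 0 ≤ n y v / f v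
  seg : ∀ y y' (a b : ℝ), 0 ≤ a → 0 ≤ b → ∀ hv : a • Y y + b • Y y' ≠ 0,
    Projectivization.mk ℝ (a • Y y + b • Y y') hv ∈ closure C
  gen : ∀ y₁ y₂ y₃, y₁ ≠ y₂ → y₁ ≠ y₃ → y₂ ≠ y₃ → ∀ l : V3 →L[ℝ] ℝ, l ≠ 0 →
    l (Y y₁) = 0 → l (Y y₂) = 0 → l (Y y₃) ≠ 0

lemma exists_good (C : Set (ℙ ℝ (Fin 3 → ℝ))) (hCopen : IsOpen C) (hCpc : ProperlyConvex C)
    (hstrict : StrictlyConvexBoundary C)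
    (hC1 : ∀ p ∈ frontier C, ∃! W : Submodule ℝ (Fin 3 → ℝ), IsSupportingLineAt C W p)
    (ξ₁ : Circle → ℙ ℝ (Fin 3 → ℝ))
    (hξ₁ : ∃ e : Circle ≃ₜ frontier C, ∀ x, (e x : ℙ ℝ (Fin 3 → ℝ)) = ξ₁ x)
    (ξ₂ : Circle → Submodule ℝ (Fin 3 → ℝ))
    (hξ₂ : ∀ x, IsSupportingLineAt C (ξ₂ x) (ξ₁ x)) :
    ∃ f Y n, Good C ξ₁ ξ₂ f Y n := by
  obtain ⟨f0, hf0, hconv⟩ := hCpc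
  obtain ⟨e, he⟩ := hξ₁
  obtain ⟨f, hf⟩ : ∃ f : V3 →L[ℝ] ℝ, ∀ v, f v = f0 v :=
    ⟨LinearMap.toContinuousLinearMap f0, fun v => rfl⟩
  have contξ : Continuous ξ₁ := by
    have : ξ₁ = fun x => (e x : ℙ ℝ V3) := by ext1 x; exact (he x).symm
    rw [this]
    exact continuous_subtype_val.comp e.continuous
  have injξ : Function.Injective ξ₁ := by
    intro a b hab
    rw [← he, ← he] at hab
    exact e.injective (Subtype.ext hab)
  have frξ : ∀ y, ξ₁ y ∈ frontier C := fun y => he y ▸ (e y).2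
  have clξ : ∀ y, ξ₁ y ∈ closure C := fun y => frontier_subset_closure (frξ y)
  have fcl : ∀ v hv, Projectivization.mk ℝ v hv ∈ closure C → f v ≠ 0 := fun v hv h => by
    rw [hf]; exact hf0 v hv h
  have clsub : closure C ⊆ affSet f := by
    intro p
    induction p using Projectivization.ind with
    | h v hv => exact fun h => (mk_mem_affSet f v hv).2 (fcl v hv h)
  set K : Set V3 := {w | f w = 1 ∧ ∃ hw : w ≠ 0, Projectivization.mk ℝ w hw ∈ C} with hK
  have Kconv : Convex ℝ K := by simpa only [hK, hf] using hconv
  have affcl : ∀ p ∈ closure C, aff f p ∈ closure K := by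
    intro p hp
    have h1 := ((contOn_aff f).mono clsub).image_closure
    refine closure_mono ?_ (h1 ⟨p, hp, rfl⟩)
    rintro _ ⟨q, hq, rfl⟩
    induction q using Projectivization.ind with
    | h v hv =>
      have hfv := fcl v hv (subset_closure hq)
      rw [aff_mk]
      have h2 : (f v)⁻¹ • v ≠ 0 := smul_ne_zero (inv_ne_zero hfv) hv
      refine ⟨by simp [hfv], h2, ?_⟩
      rwa [mk_smul_eq v hv _ h2]
  have clf : ∀ w ∈ closure K, f w = 1 := by
    intro w hw
    have : IsClosed {w | f w = 1} := isClosed_eq (by fun_prop) (by fun_prop)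
    exact closure_minimal (fun w hw => hw.1) this hw
  have clne : ∀ w ∈ closure K, w ≠ 0 := fun w hw => ne_zero_of (f := f) (by rw [clf w hw]; simp)
  have clK : ∀ w (hw : w ∈ closure K), Projectivization.mk ℝ w (clne w hw) ∈ closure C := by
    intro w hw
    -- use continuity of mk'
    have h1 : (⟨w, clne w hw⟩ : {v : V3 // v ≠ 0}) ∈
        closure ((Subtype.val : {v : V3 // v ≠ 0} → V3) ⁻¹' K) := by
      apply closure_subtype.2
      refine closure_mono ?_ hw
      intro k hk
      exact ⟨⟨k, hk.2.1⟩, hk, rfl⟩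
    have h2 := quot_mk.continuous.closure_preimage_subset C
    exact h2 (closure_mono (fun k hk => hk.2.2) h1)
  have Kne : K.Nonempty := by
    rw [← closure_nonempty_iff]
    exact ⟨_, affcl _ (clξ 1)⟩
  -- the lift
  set Y : Circle → V3 := fun y => aff f (ξ₁ y) with hY
  have contY : Continuous Y :=
    (contOn_aff f).comp_continuous contξ (fun y => clsub (clξ y))
  have Ycl : ∀ y, Y y ∈ closure K := fun y => affcl _ (clξ y)
  have fY : ∀ y, f (Y y) = 1 := fun y => clf _ (Ycl y)
  have Yne : ∀ y, Y y ≠ 0 := fun y => clne _ (Ycl y)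
  have mkY : ∀ y, Projectivization.mk ℝ (Y y) (Yne y) = ξ₁ y := by
    intro y
    have : ∀ p (hp : aff f p ≠ 0), Projectivization.mk ℝ (aff f p) hp = p := by
      intro p hp
      conv_rhs => rw [← Projectivization.mk_rep p]
      exact mk_smul_eq _ _ _ hp
    exact this _ _
  have sub : ∀ y, (ξ₁ y).submodule = Submodule.span ℝ {Y y} := by
    intro y
    rw [← mkY y, Projectivization.submodule_mk]
  have injY : Function.Injective Y := by
    intro a b hab
    apply injξ
    rw [← mkY, ← mkY]
    congr 1
  -- open cone
  have coneOpen : ∀ k ∈ K, ∀ w : V3, ∀ᶠ t in 𝓝[>] (0 : ℝ), (f (k + t • w))⁻¹ • (k + t • w) ∈ K := by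
    intro k hk w
    have h1 : IsOpen ((Projectivization.mk' ℝ : {v : V3 // v ≠ 0} → ℙ ℝ V3) ⁻¹' C) :=
      hCopen.preimage quot_mk.continuous
    have h2 : IsOpen {v : V3 | ∃ hv : v ≠ 0, Projectivization.mk ℝ v hv ∈ C} := by
      have := (isOpen_ne (x := (0 : V3))).isOpenMap_subtype_val _ h1
      convert this using 1
      ext v
      simp [Projectivization.mk'_eq_mk]
    have h3 : Tendsto (fun t : ℝ => k + t • w) (𝓝[>] 0) (𝓝 k) := by
      have : Continuous (fun t : ℝ => k + t • w) := by fun_prop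
      have h := this.tendsto 0
      simp only [zero_smul, add_zero] at h
      exact h.mono_left nhdsWithin_le_nhds
    filter_upwards [h3 (h2.mem_nhds hk.2)] with t ht
    obtain ⟨hv, hv'⟩ := ht
    have hfv := fcl _ hv (subset_closure hv')
    have h2 : (f (k + t • w))⁻¹ • (k + t • w) ≠ 0 := smul_ne_zero (inv_ne_zero hfv) hv
    refine ⟨by rw [map_smul, smul_eq_mul, inv_mul_cancel₀ hfv], h2, ?_⟩
    rwa [mk_smul_eq _ hv _ h2]
  have strictpos : ∀ φ : V3 →L[ℝ] ℝ, φ ≠ 0 → (∀ k ∈ K, 0 ≤ φ k) → ∀ k ∈ K, 0 < φ k := by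
    intro φ hφ hpos k hk
    refine lt_of_le_of_ne (hpos k hk) (fun h0 => hφ ?_)
    ext1 w
    have key : ∀ w, 0 ≤ φ w := by
      intro w
      have hfpos : ∀ᶠ t in 𝓝[>] (0 : ℝ), 0 < f (k + t • w) := by
        have : Continuous (fun t : ℝ => f (k + t • w)) := by fun_prop
        have h := (this.tendsto 0).mono_left (nhdsWithin_le_nhds (s := Set.Ioi 0))
        simp only [zero_smul, add_zero, hk.1] at h
        exact h (lt_mem_nhds one_pos)
      obtain ⟨t, h1, h2, h3⟩ := ((coneOpen k hk w).and (hfpos.and self_mem_nhdsWithin)).exists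
      have h4 := hpos _ h1
      rw [map_smul, map_add φ, map_smul φ, ← h0, zero_add, smul_eq_mul, smul_eq_mul] at h4
      have h3' : 0 < t := h3
      have h5 : 0 < (f (k + t • w))⁻¹ * t := mul_pos (inv_pos.2 h2) h3'
      rw [← mul_assoc] at h4
      exact nonneg_of_mul_nonneg_right h4 h5
    have a := key w
    have b := key (-w)
    rw [map_neg] at b
    have h : φ w = 0 := le_antisymm (by linarith) a
    exact h
  -- the normals
  have exn : ∀ y, ∃ φ : V3 →L[ℝ] ℝ, ‖φ‖ = 1 ∧ LinearMap.ker (φ : V3 →ₗ[ℝ] ℝ) = ξ₂ y ∧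
      ∀ k ∈ K, 0 ≤ φ k := by
    intro y
    obtain ⟨φ, hφ⟩ := exists_ker_eq (ξ₂ y) (hξ₂ y).1
    have hne : ∀ k ∈ K, φ k ≠ 0 := by
      intro k hk h0
      obtain ⟨h1, h2, h3⟩ := hk
      have : Projectivization.mk ℝ k h2 ∈ projLine (ξ₂ y) ∩ C := by
        refine ⟨?_, h3⟩
        rw [mem_projLine, ← hφ]
        exact h0
      rw [(hξ₂ y).2.2.2] at this
      exact this
    have hφ0 : φ ≠ 0 := by
      rintro rfl
      obtain ⟨k, hk⟩ := Kne
      exact hne k hk rfl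
    have hn : ‖φ‖ ≠ 0 := norm_ne_zero_iff.2 hφ0
    have hsgn : (∀ k ∈ K, 0 ≤ φ k) ∨ (∀ k ∈ K, φ k ≤ 0) := by
      by_contra hc
      push Not at hc
      obtain ⟨⟨k, hk, h1⟩, ⟨k', hk', h2⟩⟩ := hc
      obtain ⟨m, hm, hm0⟩ := Kconv.isPreconnected.intermediate_value hk hk'
        (f := φ) (by fun_prop) ⟨h1.le, h2.le⟩
      exact hne m hm hm0
    have kersm : ∀ c : ℝ, c ≠ 0 → LinearMap.ker ((c • φ : V3 →L[ℝ] ℝ) : V3 →ₗ[ℝ] ℝ) = ξ₂ y := by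
      intro c hc
      rw [← hφ]
      ext v
      simp [hc]
    rcases hsgn with h | h
    · refine ⟨‖φ‖⁻¹ • φ, ?_, kersm _ (inv_ne_zero hn), ?_⟩
      · rw [norm_smul, norm_inv, norm_norm, inv_mul_cancel₀ hn]
      · intro k hk
        exact mul_nonneg (by positivity) (h k hk)
    · refine ⟨(-‖φ‖⁻¹) • φ, ?_, kersm _ (neg_ne_zero.2 (inv_ne_zero hn)), ?_⟩
      · rw [norm_smul, norm_neg, norm_inv, norm_norm, inv_mul_cancel₀ hn]
      · intro k hk
        exact mul_nonneg_of_nonpos_of_nonpos (by simp) (h k hk)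
  choose n hn1 hnker hnK using exn
  have n0 : ∀ y, n y ≠ 0 := fun y h => by
    have := hn1 y
    rw [h] at this; simp at this
  have ncl : ∀ y, ∀ w ∈ closure K, 0 ≤ n y w := by
    intro y w hw
    have : IsClosed {w | 0 ≤ n y w} := isClosed_le (by fun_prop) (by fun_prop)
    exact closure_minimal (hnK y) this hw
  have nself : ∀ y, n y (Y y) = 0 := by
    intro y
    have h1 := (hξ₂ y).2.2.1
    rw [sub y, Submodule.span_singleton_le_iff_mem, ← hnker] at h1
    exact h1
  have nuniq : ∀ y (φ : V3 →L[ℝ] ℝ), ‖φ‖ = 1 → φ (Y y) = 0 → (∀ k ∈ K, 0 ≤ φ k) → n y = φ := by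
    intro y φ h1 h2 h3
    have hφ0 : φ ≠ 0 := by rintro rfl; simp at h1
    have hpos := strictpos φ hφ0 h3
    have hsup : IsSupportingLineAt C (LinearMap.ker (φ : V3 →ₗ[ℝ] ℝ)) (ξ₁ y) := by
      refine ⟨finrank_ker φ hφ0, frξ y, ?_, ?_⟩
      · rw [sub y, Submodule.span_singleton_le_iff_mem]
        exact h2
      · rw [Set.eq_empty_iff_forall_notMem]
        rintro p ⟨hp1, hp2⟩
        induction p using Projectivization.ind with
        | h v hv =>
          have hfv := fcl v hv (subset_closure hp2)
          have h4 : (f v)⁻¹ • v ≠ 0 := smul_ne_zero (inv_ne_zero hfv) hv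
          have h5 : (f v)⁻¹ • v ∈ K := by
            refine ⟨by simp [hfv], h4, ?_⟩
            rwa [mk_smul_eq v hv _ h4]
          have h6 := hpos _ h5
          have h7 : φ v = 0 := by
            rw [mem_projLine] at hp1
            exact hp1
          rw [map_smul, h7] at h6
          simp at h6
    have heq := (hC1 _ (frξ y)).unique hsup (hξ₂ y)
    obtain ⟨c, hc⟩ := exists_mul_of_ker_le (n y) φ (fun v hv => by
      have : v ∈ LinearMap.ker (n y : V3 →ₗ[ℝ] ℝ) := hv
      rw [hnker, ← heq] at this
      exact this)
    have hc' : φ = c • n y := by ext1 v; exact hc v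
    have hcn : |c| = 1 := by
      have := h1
      rw [hc', norm_smul, hn1, mul_one] at this
      exact this
    have hcpos : 0 < c := by
      obtain ⟨k, hk⟩ := Kne
      have a := hpos k hk
      rw [hc] at a
      exact pos_of_mul_pos_left a (hnK y k hk)
    rw [abs_of_pos hcpos] at hcn
    rw [hc', hcn, one_smul]
  have contn : Continuous n := by
    let S := Metric.sphere (0 : V3 →L[ℝ] ℝ) 1
    let N : Circle → S := fun y => ⟨n y, by simp [S, hn1]⟩
    have : CompactSpace S := isCompact_iff_compactSpace.1 (isCompact_sphere _ _)
    have hN : Continuous N := by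
      apply continuous_of_closed_graph
      have : {p : Circle × S | N p.1 = p.2} =
          {p : Circle × S | p.2.1 (Y p.1) = 0} ∩ ⋂ k ∈ K, {p : Circle × S | 0 ≤ p.2.1 k} := by
        ext ⟨y, φ, hφ⟩
        simp only [Set.mem_ofPred_eq, Set.mem_inter_iff, Set.mem_iInter]
        constructor
        · intro h
          have h' : n y = φ := congrArg Subtype.val h
          rw [← h']
          exact ⟨nself y, hnK y⟩
        · rintro ⟨h1, h2⟩
          exact Subtype.ext (nuniq y φ (by simpa [S] using hφ) h1 h2)
      rw [this]
      refine IsClosed.inter ?_ (isClosed_biInter fun k hk => ?_)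
      · refine isClosed_eq ?_ continuous_const
        exact (continuous_subtype_val.comp continuous_snd).clm_apply (contY.comp continuous_fst)
      · refine isClosed_le continuous_const ?_
        exact (continuous_subtype_val.comp continuous_snd).clm_apply continuous_const
    exact continuous_subtype_val.comp hN
  have mkinj : ∀ v w (hv : v ≠ 0) (hw : w ≠ 0), f v = 1 → f w = 1 →
      Projectivization.mk ℝ v hv = Projectivization.mk ℝ w hw → v = w := by
    intro v w hv hw h1 h2 h
    obtain ⟨a, ha⟩ := (Projectivization.mk_eq_mk_iff' ℝ _ _ _ _).1 h
    rw [← ha, map_smul, h2, smul_eq_mul, mul_one] at h1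
    rw [← ha, h1, one_smul]
  have npos : ∀ y y', y ≠ y' → 0 < n y (Y y') := by
    intro y y' hne
    refine lt_of_le_of_ne (ncl y _ (Ycl y')) (fun h0 => ?_)
    have hYne : Y y ≠ Y y' := fun h => hne (injY h)
    set M : V3 := (1/2 : ℝ) • Y y + (1/2 : ℝ) • Y y' with hM
    have hMcl : M ∈ closure K := Kconv.closure (Ycl y) (Ycl y') (by norm_num) (by norm_num)
      (by norm_num)
    have hMn : n y M = 0 := by simp [hM, nself, ← h0]
    have hMfr : Projectivization.mk ℝ M (clne M hMcl) ∈ frontier C := by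
      rw [hCopen.frontier_eq]
      refine ⟨clK M hMcl, fun hMC => ?_⟩
      have := strictpos (n y) (n0 y) (hnK y) M ⟨clf M hMcl, _, hMC⟩
      rw [hMn] at this
      exact lt_irrefl _ this
    have e1 : ξ₁ y ≠ Projectivization.mk ℝ M (clne M hMcl) := by
      intro h
      rw [← mkY] at h
      have h := mkinj _ _ _ _ (fY y) (clf M hMcl) h
      apply hYne
      have h2 : (2:ℝ) • Y y = Y y + Y y' := by
        conv_lhs => rw [h, hM]
        rw [smul_add, smul_smul, smul_smul]; norm_num
      rw [two_smul] at h2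
      exact add_left_cancel h2
    have e2 : ξ₁ y' ≠ Projectivization.mk ℝ M (clne M hMcl) := by
      intro h
      rw [← mkY] at h
      have h := mkinj _ _ _ _ (fY y') (clf M hMcl) h
      apply hYne
      have h2 : (2:ℝ) • Y y' = Y y + Y y' := by
        conv_lhs => rw [h, hM]
        rw [smul_add, smul_smul, smul_smul]; norm_num
      rw [two_smul] at h2
      exact (add_right_cancel h2).symm
    refine hstrict _ _ _ (frξ y) (frξ y') hMfr (fun h => hne (injξ h)) e1 e2 (ξ₂ y)
      (hξ₂ y).1 ⟨?_, ?_, ?_⟩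
    · exact (hξ₂ y).2.2.1
    · rw [sub, Submodule.span_singleton_le_iff_mem, ← hnker]
      exact h0.symm
    · rw [Projectivization.submodule_mk, Submodule.span_singleton_le_iff_mem, ← hnker]
      exact hMn
  refine ⟨f, Y, n, contY, contn, fY, sub, nself, npos, hnker, fcl, ?_, ?_, ?_⟩
  · intro v hv h y
    have := ncl y _ (affcl _ h)
    rw [aff_mk, map_smul, smul_eq_mul, inv_mul_eq_div] at this
    exact this
  · intro y y' a b ha hb hv
    have hab : 0 < a + b := by
      rcases ha.eq_or_lt with h | h
      · rcases hb.eq_or_lt with h' | h'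
        · exfalso; apply hv; simp [← h, ← h']
        · linarith
      · linarith
    have h1 : (a / (a+b)) • Y y + (b / (a+b)) • Y y' ∈ closure K :=
      Kconv.closure (Ycl y) (Ycl y') (by positivity) (by positivity) (by field_simp)
    have h2 := clK _ h1
    convert h2 using 1
    rw [Projectivization.mk_eq_mk_iff']
    refine ⟨a + b, ?_⟩
    rw [smul_add, smul_smul, smul_smul, mul_div_cancel₀ _ hab.ne', mul_div_cancel₀ _ hab.ne']
  · intro y₁ y₂ y₃ h12 h13 h23 l hl h1 h2 h3
    refine hstrict _ _ _ (frξ y₁) (frξ y₂) (frξ y₃) (fun h => h12 (injξ h))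
      (fun h => h13 (injξ h)) (fun h => h23 (injξ h)) (LinearMap.ker (l : V3 →ₗ[ℝ] ℝ))
      (finrank_ker l hl) ⟨?_, ?_, ?_⟩ <;>
    rw [sub, Submodule.span_singleton_le_iff_mem] <;> assumption

lemma posOriented_iff {a c : ℝ} (hac : a < c) (hca : c < a + 2 * Real.pi) (y : Circle) :
    PosOriented (Circle.exp a) y (Circle.exp c) ↔ ∃ b, a < b ∧ b < c ∧ Circle.exp b = y := by
  constructor
  · rintro ⟨a', b', c', h1, h2, h3, h4, h5, h6⟩
    obtain ⟨m, hm⟩ := Circle.exp_eq_exp.1 h1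
    obtain ⟨k, hk⟩ := Circle.exp_eq_exp.1 h3
    have hpi := Real.pi_pos
    have hkm : k = m := by
      have e1 : ((k - m : ℤ) : ℝ) < 1 := by
        push_cast
        by_contra hc
        push Not at hc
        nlinarith
      have e2 : (-1 : ℝ) < ((k - m : ℤ) : ℝ) := by
        push_cast
        by_contra hc
        push Not at hc
        nlinarith
      have e1' : k - m < 1 := by exact_mod_cast e1
      have e2' : -1 < k - m := by exact_mod_cast e2
      omega
    subst hkm
    refine ⟨b' - k * (2 * Real.pi), by linarith, by linarith, ?_⟩
    rw [← h2, Circle.exp_eq_exp]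
    exact ⟨-k, by push_cast; ring⟩
  · rintro ⟨b, h1, h2, h3⟩
    exact ⟨a, b, c, rfl, h3, rfl, h1, h2, hca⟩

lemma exists_angles (x z : Circle) (hxz : x ≠ z) :
    ∃ a c : ℝ, Circle.exp a = x ∧ Circle.exp c = z ∧ a < c ∧ c < a + 2 * Real.pi := by
  obtain ⟨a, rfl⟩ := Circle.exp_surjective x
  obtain ⟨c0, rfl⟩ := Circle.exp_surjective z
  obtain ⟨c, hc, hcc⟩ := Circle.periodic_exp.exists_mem_Ico Real.two_pi_pos c0 a
  refine ⟨a, c, rfl, hcc.symm, lt_of_le_of_ne hc.1 ?_, hc.2⟩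
  rintro rfl
  exact hxz hcc.symm

lemma half {C : Set (ℙ ℝ V3)} {ξ₁ : Circle → ℙ ℝ V3} {ξ₂ : Circle → Submodule ℝ V3}
    {f : V3 →L[ℝ] ℝ} {Y : Circle → V3} {n : Circle → V3 →L[ℝ] ℝ} (G : Good C ξ₁ ξ₂ f Y n)
    (x z : Circle) (hxz : x ≠ z) :
    ∃ η : Circle → ℙ ℝ V3,
      (∀ y, y ≠ x → y ≠ z →
        (η y).submodule = ((ξ₁ x).submodule ⊔ (ξ₁ z).submodule) ⊓ ξ₂ y ∧
        η y ∉ closure C) ∧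
      (∃ e : {y : Circle // PosOriented x y z} ≃ₜ
          ↥(projLine ((ξ₁ x).submodule ⊔ (ξ₁ z).submodule) \ closure C),
        ∀ a, (e a : ℙ ℝ (Fin 3 → ℝ)) = η ↑a) := by
  have nn : ∀ y y', 0 ≤ n y (Y y') := by
    intro y y'
    by_cases h : y = y'
    · rw [h, G.nself]
    · exact (G.npos y y' h).le
  have n0 : ∀ y y', n y (Y y') = 0 → y = y' := by
    intro y y' h
    by_contra hne
    exact (G.npos y y' hne).ne' h
  have hA : 0 < n z (Y x) := G.npos z x hxz.symm
  have hB : 0 < n x (Y z) := G.npos x z hxz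
  have pq : ∀ y, 0 < n y (Y x) + n y (Y z) := by
    intro y
    by_cases h : y = x
    · subst h; have := nn y y; linarith
    · have := G.npos y x h; have := nn y z; linarith
  have combne : ∀ α β : ℝ, α • Y x + β • Y z = 0 → α = 0 ∧ β = 0 := by
    intro α β h
    have h1 := congrArg (n x) h
    have h2 := congrArg (n z) h
    simp [G.nself] at h1 h2
    exact ⟨h2.resolve_right hA.ne', h1.resolve_right hB.ne'⟩
  have hvec : ∀ y, n y (Y z) • Y x + (-n y (Y x)) • Y z ≠ 0 := by
    intro y h
    obtain ⟨h1, h2⟩ := combne _ _ h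
    have := pq y
    linarith
  have memL : ∀ v, v ∈ (ξ₁ x).submodule ⊔ (ξ₁ z).submodule ↔
      ∃ α β : ℝ, v = α • Y x + β • Y z := by
    intro v
    rw [G.sub, G.sub, Submodule.mem_sup]
    constructor
    · rintro ⟨a, ha, b, hb, rfl⟩
      obtain ⟨α, rfl⟩ := Submodule.mem_span_singleton.1 ha
      obtain ⟨β, rfl⟩ := Submodule.mem_span_singleton.1 hb
      exact ⟨α, β, rfl⟩
    · rintro ⟨α, β, rfl⟩
      exact ⟨_, Submodule.mem_span_singleton.2 ⟨α, rfl⟩, _,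
        Submodule.mem_span_singleton.2 ⟨β, rfl⟩, rfl⟩
  have prop : ∀ y (α β : ℝ), α * n y (Y x) + β * n y (Y z) = 0 →
      ((α - β) / (n y (Y x) + n y (Y z))) • (n y (Y z) • Y x + (-n y (Y x)) • Y z) =
        α • Y x + β • Y z := by
    intro y α β h
    have hp := (pq y).ne'
    rw [smul_add, smul_smul, smul_smul]
    congr 2
    · field_simp; linarith
    · field_simp; linarith
  set η : Circle → ℙ ℝ V3 := fun y => Projectivization.mk ℝ _ (hvec y) with hη
  have ηcl : ∀ y, y ≠ x → y ≠ z → η y ∉ closure C := by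
    intro y hyx hyz hcl
    have hf := G.fcl _ _ hcl
    have h1 := G.ncl _ _ hcl x
    have h2 := G.ncl _ _ hcl z
    have px := G.npos y x hyx
    have pz := G.npos y z hyz
    set F := f (n y (Y z) • Y x + (-n y (Y x)) • Y z)
    simp only [map_add, map_smul, G.nself, smul_eq_mul, mul_zero, add_zero, zero_add] at h1 h2
    rcases lt_or_gt_of_ne hf with h | h
    · have := div_neg_of_pos_of_neg (mul_pos pz hA) h
      linarith
    · have := div_neg_of_neg_of_pos (mul_neg_of_neg_of_pos (neg_neg_of_pos px) hB) h
      linarith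
  have ηsub : ∀ y, (η y).submodule = ((ξ₁ x).submodule ⊔ (ξ₁ z).submodule) ⊓ ξ₂ y := by
    intro y
    rw [hη, Projectivization.submodule_mk]
    apply le_antisymm
    · rw [Submodule.span_singleton_le_iff_mem]
      refine ⟨(memL _).2 ⟨_, _, rfl⟩, ?_⟩
      rw [← G.kern]
      show n y _ = 0
      simp only [map_add, map_smul, smul_eq_mul]
      ring
    · rintro v ⟨h1, h2⟩
      obtain ⟨α, β, rfl⟩ := (memL v).1 h1
      rw [← G.kern] at h2
      have h3 : n y (α • Y x + β • Y z) = 0 := h2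
      simp only [map_add, map_smul, smul_eq_mul] at h3
      exact Submodule.mem_span_singleton.2 ⟨_, prop y α β h3⟩
  refine ⟨η, fun y h1 h2 => ⟨ηsub y, ηcl y h1 h2⟩, ?_⟩
  -- continuity
  have cn : ∀ w, Continuous fun y => n y w := fun w => G.contn.clm_apply continuous_const
  have contη : Continuous η := by
    have h1 : Continuous fun y => n y (Y z) • Y x + (-n y (Y x)) • Y z :=
      ((cn _).smul continuous_const).add ((cn _).neg.smul continuous_const)
    exact quot_mk.continuous.comp (h1.subtype_mk hvec)
  set s : Circle → ℝ := fun y => n y (Y x) / (n y (Y x) + n y (Y z)) with hs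
  have conts : Continuous s := (cn _).div ((cn _).add (cn _)) (fun y => (pq y).ne')
  have sx : s x = 0 := by simp [hs, G.nself]
  have sz : s z = 1 := by simp [hs, G.nself, hA.ne']
  have s0 : ∀ y, s y = 0 → y = x := by
    intro y h
    rcases div_eq_zero_iff.1 h with h | h
    · exact n0 _ _ h
    · exact absurd h (pq y).ne'
  have s1 : ∀ y, s y = 1 → y = z := by
    intro y h
    rw [hs] at h
    have := (div_eq_one_iff_eq (pq y).ne').1 h
    exact n0 _ _ (by linarith)
  -- the functional cutting out the line
  have hZnotX : Y z ∉ Submodule.span ℝ {Y x} := by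
    intro h
    obtain ⟨c, hc⟩ := Submodule.mem_span_singleton.1 h
    have := congrArg (n x) hc
    simp [G.nself] at this
    exact hB.ne' this.symm
  obtain ⟨l, hl⟩ : ∃ l : V3 →L[ℝ] ℝ,
      LinearMap.ker (l : V3 →ₗ[ℝ] ℝ) = (ξ₁ x).submodule ⊔ (ξ₁ z).submodule := by
    apply exists_ker_eq
    have h1 : (ξ₁ x).submodule ⊔ (ξ₁ z).submodule =
        Submodule.span ℝ (Set.range ![Y x, Y z]) := by
      rw [G.sub, G.sub, ← Submodule.span_union]
      congr 1
      ext v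
      simp
    have h2 : LinearIndependent ℝ ![Y x, Y z] := by
      rw [LinearIndependent.pair_iff]
      exact combne
    rw [h1, finrank_span_eq_card h2]
    simp
  have lker : ∀ v, l v = 0 ↔ ∃ α β : ℝ, v = α • Y x + β • Y z := by
    intro v
    rw [← memL, ← hl]
    rfl
  have lx : l (Y x) = 0 := (lker _).2 ⟨1, 0, by simp⟩
  have lz : l (Y z) = 0 := (lker _).2 ⟨0, 1, by simp⟩
  have l0 : l ≠ 0 := by
    intro h
    have h1 := finrank_ker (n x) (fun h => by rw [h] at hB; simp at hB)
    have h2 : LinearMap.ker (l : V3 →ₗ[ℝ] ℝ) = ⊤ := by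
      rw [h]; ext v; simp
    have h3 : ∀ v, ∃ α β : ℝ, v = α • Y x + β • Y z := fun v => (lker v).1 (by simp [h])
    have h4 : LinearMap.ker (n x : V3 →ₗ[ℝ] ℝ) ≤ Submodule.span ℝ {Y x} := by
      intro v hv
      obtain ⟨α, β, rfl⟩ := h3 v
      have h5 : n x (α • Y x + β • Y z) = 0 := hv
      simp [G.nself, hB.ne'] at h5
      exact Submodule.mem_span_singleton.2 ⟨α, by simp [h5]⟩
    have h5 := Submodule.finrank_mono h4
    have h6 : finrank ℝ (Submodule.span ℝ {Y x}) = 1 :=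
      finrank_span_singleton (ne_zero_of (f := f) (by rw [G.fY]; simp))
    omega
  have lY : ∀ y, y ≠ x → y ≠ z → l (Y y) ≠ 0 := fun y h1 h2 =>
    G.gen x z y hxz h1.symm h2.symm l l0 lx lz
  -- injectivity on a side
  have inj_side : ∀ y₁ y₂, s y₁ = s y₂ → 0 < l (Y y₁) * l (Y y₂) → y₁ = y₂ := by
    intro y₁ y₂ hs12 hll
    have h1 := pq y₁
    have h2 := pq y₂
    set N₁ := n y₁ (Y x) + n y₁ (Y z) with hN1
    set N₂ := n y₂ (Y x) + n y₂ (Y z) with hN2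
    have e1 : n y₁ (Y x) * N₂ = n y₂ (Y x) * N₁ := by
      have h := hs12
      simp only [hs] at h
      rw [div_eq_div_iff h1.ne' h2.ne'] at h
      exact h
    have e2 : n y₁ (Y z) * N₂ = n y₂ (Y z) * N₁ := by
      have : n y₁ (Y z) = N₁ - n y₁ (Y x) := by rw [hN1]; ring
      rw [this]
      have : n y₂ (Y z) = N₂ - n y₂ (Y x) := by rw [hN2]; ring
      rw [this]
      linarith
    obtain ⟨c, hc⟩ := exists_mul_of_ker_le l (N₂ • n y₁ - N₁ • n y₂) (by
      intro v hv
      obtain ⟨α, β, rfl⟩ := (lker v).1 hv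
      simp only [sub_apply, smul_apply, map_add, map_smul,
        smul_eq_mul]
      linear_combination α * e1 + β * e2)
    have c1 := hc (Y y₁)
    have c2 := hc (Y y₂)
    simp only [sub_apply, smul_apply, smul_eq_mul,
      G.nself, mul_zero, zero_sub, sub_zero] at c1 c2
    by_contra hne
    have p12 := mul_pos h2 (G.npos y₁ y₂ hne)
    have p21 := mul_pos h1 (G.npos y₂ y₁ (Ne.symm hne))
    have e3 : (c * l (Y y₁)) * (c * l (Y y₂)) < 0 := by
      rw [← c1, ← c2]
      nlinarith
    have e4 : 0 ≤ (c * c) * (l (Y y₁) * l (Y y₂)) := mul_nonneg (mul_self_nonneg c) hll.le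
    nlinarith
  -- the inverse parameter
  set h : V3 →L[ℝ] ℝ := n z (Y x) • n x - n x (Y z) • n z with hh
  have hcomb : ∀ α β : ℝ, h (α • Y x + β • Y z) = n z (Y x) * n x (Y z) * (β - α) := by
    intro α β
    simp only [hh, sub_apply, smul_apply, map_add,
      map_smul, smul_eq_mul, G.nself]
    ring
  set g : ℙ ℝ V3 → ℝ := fun p => n z (Y x) * n x p.rep / h p.rep with hg
  have gmk : ∀ v hv, g (Projectivization.mk ℝ v hv) = n z (Y x) * n x v / h v := by
    intro v hv
    obtain ⟨a, ha⟩ := Projectivization.exists_smul_eq_mk_rep ℝ v hv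
    simp only [hg]
    rw [← ha, Units.smul_def, map_smul, map_smul, smul_eq_mul, smul_eq_mul, mul_left_comm,
      mul_div_mul_left _ _ a.ne_zero]
  have contg : ContinuousOn g (affSet h) := by
    refine contOn_lift g (fun v => n z (Y x) * n x v / h v) h (fun v hv _ => gmk v hv) ?_
    exact ContinuousOn.div (by fun_prop) (by fun_prop) (fun v hv => hv)
  have gη : ∀ y, g (η y) = s y := by
    intro y
    simp only [hη]
    rw [gmk, hcomb]
    simp only [map_add, map_smul, smul_eq_mul, G.nself, hs]
    have := pq y
    have : - n y (Y x) - n y (Y z) ≠ 0 := by linarith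
    rw [div_eq_div_iff (by positivity) (pq y).ne']
    ring
  have signs : ∀ (α β : ℝ) hv, Projectivization.mk ℝ (α • Y x + β • Y z) hv ∉ closure C →
      (0 < α ∧ β < 0) ∨ (α < 0 ∧ 0 < β) := by
    intro α β hv hcl
    have a1 : ¬ (0 ≤ α ∧ 0 ≤ β) := fun hab => hcl (G.seg x z α β hab.1 hab.2 hv)
    have a2 : ¬ (α ≤ 0 ∧ β ≤ 0) := by
      intro hab
      have hv' : (-α) • Y x + (-β) • Y z ≠ 0 := by
        intro h0
        apply hv
        rw [neg_smul, neg_smul, ← neg_add, neg_eq_zero] at h0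
        exact h0
      have := G.seg x z (-α) (-β) (by linarith [hab.1]) (by linarith [hab.2]) hv'
      apply hcl
      convert this using 1
      rw [Projectivization.mk_eq_mk_iff']
      exact ⟨-1, by simp⟩
    by_contra hc
    push Not at hc a1 a2
    rcases lt_trichotomy α 0 with h1 | h1 | h1
    · have := hc.2 h1; have := a2 h1.le; linarith
    · have := a1 h1.ge; have := a2 h1.le; linarith
    · have := hc.1 h1; have := a1 h1.le; linarith
  have Tsub : projLine ((ξ₁ x).submodule ⊔ (ξ₁ z).submodule) \ closure C ⊆ affSet h := by
    rintro p ⟨hp1, hp2⟩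
    induction p using Projectivization.ind with
    | h v hv =>
      rw [mem_projLine, memL] at hp1
      obtain ⟨α, β, rfl⟩ := hp1
      rw [mk_mem_affSet, hcomb]
      have : β - α ≠ 0 := by
        rcases signs α β hv hp2 with h | h
        · linarith [h.1, h.2]
        · linarith [h.1, h.2]
      positivity
  -- the arc
  obtain ⟨a, c, ha, hc, hac, hca⟩ := exists_angles x z hxz
  have arc : ∀ y, PosOriented x y z ↔ ∃ b, a < b ∧ b < c ∧ Circle.exp b = y := by
    intro y
    rw [← ha, ← hc]
    exact posOriented_iff hac hca y
  have arcne : ∀ b, a < b → b < c → Circle.exp b ≠ x ∧ Circle.exp b ≠ z := by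
    intro b h1 h2
    have hinj := Circle.exp_injOn_Icc (a := a) (b := c) (by linarith)
    constructor
    · rw [← ha]; intro h
      have := hinj ⟨h1.le, h2.le⟩ ⟨le_refl a, hac.le⟩ h
      linarith
    · rw [← hc]; intro h
      have := hinj ⟨h1.le, h2.le⟩ ⟨hac.le, le_refl c⟩ h
      linarith
  have contexp : Continuous (fun b : ℝ => Circle.exp b) := Circle.exp.continuous
  have side : ∀ b₁ b₂, a < b₁ → b₁ < c → a < b₂ → b₂ < c →
      0 < l (Y (Circle.exp b₁)) * l (Y (Circle.exp b₂)) := by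
    intro b₁ b₂ h1 h2 h3 h4
    have hcont : ContinuousOn (fun b => l (Y (Circle.exp b))) (Set.Ioo a c) :=
      (l.continuous.comp (G.contY.comp contexp)).continuousOn
    have hne : ∀ b, a < b → b < c → l (Y (Circle.exp b)) ≠ 0 := fun b h h' =>
      lY _ (arcne b h h').1 (arcne b h h').2
    have key : ∀ b₁ b₂, a < b₁ → b₁ < c → a < b₂ → b₂ < c → l (Y (Circle.exp b₁)) < 0 →
        0 < l (Y (Circle.exp b₂)) → False := by
      intro b₁ b₂ h1 h2 h3 h4 h5 h6
      obtain ⟨b, hb, hb0⟩ := isPreconnected_Ioo.intermediate_value (s := Set.Ioo a c)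
        ⟨h1, h2⟩ ⟨h3, h4⟩ hcont ⟨h5.le, h6.le⟩
      exact hne b hb.1 hb.2 hb0
    rcases lt_or_gt_of_ne (hne b₁ h1 h2) with h5 | h5 <;>
    rcases lt_or_gt_of_ne (hne b₂ h3 h4) with h6 | h6
    · exact mul_pos_of_neg_of_neg h5 h6
    · exact (key b₁ b₂ h1 h2 h3 h4 h5 h6).elim
    · exact (key b₂ b₁ h3 h4 h1 h2 h6 h5).elim
    · exact mul_pos h5 h6
  have injF : Set.InjOn s ((fun b : ℝ => Circle.exp b) '' Set.Icc a c) := by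
    rintro _ ⟨b₁, hb1, rfl⟩ _ ⟨b₂, hb2, rfl⟩ heq
    simp only at heq ⊢
    by_cases h1 : Circle.exp b₁ = x
    · rw [h1, sx] at heq; rw [h1, s0 _ heq.symm]
    by_cases h2 : Circle.exp b₁ = z
    · rw [h2, sz] at heq; rw [h2, s1 _ heq.symm]
    by_cases h3 : Circle.exp b₂ = x
    · rw [h3, sx] at heq; rw [h3, s0 _ heq]
    by_cases h4 : Circle.exp b₂ = z
    · rw [h4, sz] at heq; rw [h4, s1 _ heq]
    have o : ∀ b ∈ Set.Icc a c, Circle.exp b ≠ x → Circle.exp b ≠ z → a < b ∧ b < c := by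
      intro b hb hbx hbz
      refine ⟨lt_of_le_of_ne hb.1 ?_, lt_of_le_of_ne hb.2 ?_⟩
      · rintro rfl; exact hbx ha
      · rintro rfl; exact hbz hc
    have o1 := o b₁ hb1 h1 h2
    have o2 := o b₂ hb2 h3 h4
    exact inj_side _ _ heq (side b₁ b₂ o1.1 o1.2 o2.1 o2.2)
  -- embedding
  have emb : IsEmbedding (fun y : {y : Circle // PosOriented x y z} => s y.1) := by
    let D : Set Circle := (fun b : ℝ => Circle.exp b) '' Set.Icc a c
    have hD : IsCompact D := isCompact_Icc.image contexp
    have : CompactSpace D := isCompact_iff_compactSpace.1 hD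
    have h1 : IsEmbedding (fun y : D => s y.1) :=
      ((conts.comp continuous_subtype_val).isClosedEmbedding
        (fun u v huv => Subtype.ext (injF u.2 v.2 huv))).isEmbedding
    have hsub : {y | PosOriented x y z} ⊆ D := by
      intro y hy
      obtain ⟨b, hb1, hb2, hb3⟩ := (arc y).1 hy
      exact ⟨b, ⟨hb1.le, hb2.le⟩, hb3⟩
    exact h1.comp (IsEmbedding.inclusion hsub)
  have ηT : ∀ y : {y : Circle // PosOriented x y z},
      η y.1 ∈ projLine ((ξ₁ x).submodule ⊔ (ξ₁ z).submodule) \ closure C := by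
    rintro ⟨y, hy⟩
    obtain ⟨b, hb1, hb2, rfl⟩ := (arc y).1 hy
    refine ⟨?_, ηcl _ (arcne b hb1 hb2).1 (arcne b hb1 hb2).2⟩
    simp only [hη]
    rw [mem_projLine, memL]
    exact ⟨_, _, rfl⟩
  let H : {y : Circle // PosOriented x y z} →
      ↥(projLine ((ξ₁ x).submodule ⊔ (ξ₁ z).submodule) \ closure C) := fun y => ⟨η y.1, ηT y⟩
  have contH : Continuous H := (contη.comp continuous_subtype_val).subtype_mk _
  have embH : IsEmbedding H := by
    refine IsEmbedding.of_comp (g := fun p => g p.1) contH ?_ ?_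
    · exact contg.comp_continuous continuous_subtype_val (fun p => Tsub p.2)
    · convert emb using 1
      ext y
      exact gη y.1
  have surjH : Function.Surjective H := by
    rintro ⟨p, hp1, hp2⟩
    induction p using Projectivization.ind with
    | h v hv =>
      have hp1' := hp1
      rw [mem_projLine, memL] at hp1'
      obtain ⟨α, β, rfl⟩ := hp1'
      have hsg := signs α β hv hp2
      have hd : β - α ≠ 0 := by
        rcases hsg with h | h
        · linarith [h.1, h.2]
        · linarith [h.1, h.2]
      have h01 : β / (β - α) ∈ Set.Icc (s (Circle.exp a)) (s (Circle.exp c)) ∧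
          β / (β - α) ≠ 0 ∧ β / (β - α) ≠ 1 := by
        rw [ha, hc, sx, sz]
        rcases hsg with ⟨h1, h2⟩ | ⟨h1, h2⟩
        · refine ⟨⟨div_nonneg_of_nonpos h2.le (by linarith), ?_⟩, ?_, ?_⟩
          · rw [div_le_one_of_neg (by linarith)]; linarith
          · exact div_ne_zero h2.ne hd
          · rw [Ne, div_eq_one_iff_eq hd]; intro h; linarith
        · refine ⟨⟨div_nonneg h2.le (by linarith), ?_⟩, ?_, ?_⟩
          · rw [div_le_one (by linarith)]; linarith
          · exact div_ne_zero h2.ne' hd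
          · rw [Ne, div_eq_one_iff_eq hd]; intro h; linarith
      obtain ⟨hI, hne0, hne1⟩ := h01
      obtain ⟨b, hb, hbs⟩ := intermediate_value_Icc hac.le
        (f := fun b => s (Circle.exp b)) (conts.comp contexp).continuousOn hI
      simp only at hbs
      have hb1 : a < b := lt_of_le_of_ne hb.1 (by
        rintro rfl; rw [ha, sx] at hbs; exact hne0 hbs.symm)
      have hb2 : b < c := lt_of_le_of_ne hb.2 (by
        rintro rfl; rw [hc, sz] at hbs; exact hne1 hbs.symm)
      refine ⟨⟨Circle.exp b, (arc _).2 ⟨b, hb1, hb2, rfl⟩⟩, ?_⟩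
      apply Subtype.ext
      show η (Circle.exp b) = _
      symm
      simp only [hη]
      rw [Projectivization.mk_eq_mk_iff']
      refine ⟨_, prop (Circle.exp b) α β ?_⟩
      simp only [hs] at hbs
      rw [div_eq_div_iff (pq _).ne' hd] at hbs
      linarith
  exact ⟨embH.toHomeomorphOfSurjective surjH, fun y => rfl⟩

/-- For distinct `x, z`: for `y ∉ {x,z}` the point `(x¹ + z¹) ∩ ξ²(y)` lies
outside the closure of `C`, and `y ↦ (x¹ + z¹) ∩ ξ²(y)` restricts to a homeomorphism from each
of the two open arcs bounded by `x` and `z` onto `ℙ(x¹ + z¹) ∖ closure C`. -/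
theorem statement_3
    (C : Set (ℙ ℝ (Fin 3 → ℝ))) (hCopen : IsOpen C) (hCpc : ProperlyConvex C)
    (hstrict : StrictlyConvexBoundary C)
    (hC1 : ∀ p ∈ frontier C, ∃! W : Submodule ℝ (Fin 3 → ℝ), IsSupportingLineAt C W p)
    (ξ₁ : Circle → ℙ ℝ (Fin 3 → ℝ))
    (hξ₁ : ∃ e : Circle ≃ₜ frontier C, ∀ x, (e x : ℙ ℝ (Fin 3 → ℝ)) = ξ₁ x)
    (ξ₂ : Circle → Submodule ℝ (Fin 3 → ℝ))
    (hξ₂ : ∀ x, IsSupportingLineAt C (ξ₂ x) (ξ₁ x))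
    (x z : Circle) (hxz : x ≠ z) :
    ∃ η : Circle → ℙ ℝ (Fin 3 → ℝ),
      (∀ y, y ≠ x → y ≠ z →
        (η y).submodule = ((ξ₁ x).submodule ⊔ (ξ₁ z).submodule) ⊓ ξ₂ y ∧
        η y ∉ closure C) ∧
      (∃ e : {y : Circle // PosOriented x y z} ≃ₜ
          ↥(projLine ((ξ₁ x).submodule ⊔ (ξ₁ z).submodule) \ closure C),
        ∀ a, (e a : ℙ ℝ (Fin 3 → ℝ)) = η ↑a) ∧
      (∃ e : {y : Circle // PosOriented z y x} ≃ₜ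
          ↥(projLine ((ξ₁ x).submodule ⊔ (ξ₁ z).submodule) \ closure C),
        ∀ a, (e a : ℙ ℝ (Fin 3 → ℝ)) = η ↑a) := by
  obtain ⟨f, Y, n, G⟩ := exists_good C hCopen hCpc hstrict hC1 ξ₁ hξ₁ ξ₂ hξ₂
  obtain ⟨η, h1, h2⟩ := half G x z hxz
  obtain ⟨η', h1', e', h2'⟩ := half G z x hxz.symm
  refine ⟨η, h1, h2, ?_⟩
  have hne : ∀ y, PosOriented z y x → y ≠ x ∧ y ≠ z := by
    rintro y ⟨a, b, c, rfl, rfl, rfl, k1, k2, k3⟩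
    have hinj := Circle.exp_injOn_Icc (a := a) (b := c) (by linarith)
    constructor
    · intro h
      have := hinj ⟨k1.le, k2.le⟩ ⟨(k1.trans k2).le, le_refl c⟩ h
      linarith
    · intro h
      have := hinj ⟨k1.le, k2.le⟩ ⟨le_refl a, (k1.trans k2).le⟩ h
      linarith
  have hset : projLine ((ξ₁ z).submodule ⊔ (ξ₁ x).submodule) \ closure C =
      projLine ((ξ₁ x).submodule ⊔ (ξ₁ z).submodule) \ closure C := by
    rw [sup_comm]
  refine ⟨e'.trans (Homeomorph.setCongr hset), fun y => ?_⟩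
  have k := hne y.1 y.2
  apply Projectivization.submodule_injective
  have k2 : (η' y.1).submodule = (η y.1).submodule := by
    rw [(h1 y.1 k.1 k.2).1, sup_comm, ← (h1' y.1 k.2 k.1).1]
  rw [← k2, ← h2' y]
  rfl

end CFF
end
end
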